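/- Let n ≥ 2 be even and let A be the n-qubit brickwork architecture consisting of 2nT alternating layers (odd layers apply gates at the pairs (1,2), (3,4), …, (n−1,n); even layers apply gates at the pairs (2,3), (4,5), …, (n−2,n−1)), grouped into T consecutive blocks of 2n layers with L = n(n−1) gates per block, so that the total gate count is R = T·n(n−1). If T ≤ 4^n − 1, then for μ-almost every x ∈ SU(4)^{×R}, the implemented unitary satisfies C_u(F^A(x)) ≥ R/(9n(n−1)) − n/3. -/

import Mathlib

open scoped Matrix ENNReal Classical Kronecker ComplexOrder
open MeasureTheory

/-! ## Basic objects: qubit bases, gates, architectures, contraction maps -/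

/-- Computational-basis index set for `n` qubits. -/
abbrev QubitBasis (n : ℕ) := Fin n → Fin 2

/-- `2^n × 2^n` complex matrices, indexed by the computational basis of `n` qubits. -/
abbrev NMatrix (n : ℕ) := Matrix (QubitBasis n) (QubitBasis n) ℂ

/-- The special unitary group `SU(4)` of two-qubit gates. -/
abbrev SU4 := Matrix.specialUnitaryGroup (Fin 4) ℂ

/-- An architecture on `n` qubits with `R` gates: a list of ordered pairs of distinct qubits. -/
def Architecture (n R : ℕ) := Fin R → {p : Fin n × Fin n // p.1 ≠ p.2}

/-- Identification of a pair of one-qubit basis indices with a two-qubit basis index. -/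
def pairIdx (a b : Fin 2) : Fin 4 := ⟨2 * a.val + b.val, by omega⟩

/-- The `n`-qubit matrix given by letting the two-qubit matrix `u` act on the
tensor factors `p.1` and `p.2`, and as the identity on all other factors. -/
noncomputable def embedGate {n : ℕ} (p : Fin n × Fin n) (u : Matrix (Fin 4) (Fin 4) ℂ) :
    NMatrix n := fun a b =>
  if (∀ i, i ≠ p.1 → i ≠ p.2 → a i = b i)
  then u (pairIdx (a p.1) (a p.2)) (pairIdx (b p.1) (b p.2)) else 0

/-- The list of `n`-qubit gates obtained by substituting the gates `x` into
the architecture `A`. -/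
noncomputable def gateList {n R : ℕ} (A : Architecture n R) (x : Fin R → SU4) :
    List (NMatrix n) :=
  List.ofFn fun i => embedGate (A i).1 (x i : Matrix (Fin 4) (Fin 4) ℂ)

/-- The contraction map `F^A` of an architecture `A`: it sends a tuple of two-qubit gates
`(u_1, …, u_R)` to the `n`-qubit unitary `(u_R)_{p_R} ⋯ (u_1)_{p_1}`. -/
noncomputable def contract {n R : ℕ} (A : Architecture n R) (x : Fin R → SU4) : NMatrix n :=
  ((gateList A x).reverse).prod

/-- The exact circuit complexity: the least number `R` of two-qubit gates, arranged in any
architecture, implementing the matrix `U`. -/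
noncomputable def Cu (n : ℕ) (U : NMatrix n) : ℕ :=
  sInf {R | ∃ A : Architecture n R, ∃ x : Fin R → SU4, contract A x = U}

/-- The all-zeros computational basis state `|0^n⟩`. -/
noncomputable def ket0 (n : ℕ) : QubitBasis n → ℂ := fun a => if a = fun _ => 0 then 1 else 0

/-- The exact state complexity: the least number `R` of two-qubit gates, arranged in any
architecture, producing `ψ` from `|0^n⟩`. -/
noncomputable def Cstate (n : ℕ) (ψ : QubitBasis n → ℂ) : ℕ :=
  sInf {R | ∃ A : Architecture n R, ∃ x : Fin R → SU4, (contract A x) *ᵥ ket0 n = ψ}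

/-- The gates with indices `lo ≤ i < hi` of `A` form a causal slice with sink qubit `t`:
every qubit `q` is connected to `t` by a path through gates of the slice, taken in
increasing index order. -/
def IsCausalSliceWith {n R : ℕ} (A : Architecture n R) (lo hi : ℕ) (t : Fin n) : Prop :=
  ∀ q : Fin n, ∃ (m : ℕ) (idx : Fin m → Fin R) (qs : Fin (m + 1) → Fin n),
    StrictMono idx ∧ (∀ l, lo ≤ (idx l : ℕ) ∧ (idx l : ℕ) < hi) ∧
    qs 0 = q ∧ qs (Fin.last m) = t ∧
    ∀ l : Fin m,
      (qs l.castSucc = (A (idx l)).1.1 ∨ qs l.castSucc = (A (idx l)).1.2) ∧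
      (qs l.succ = (A (idx l)).1.1 ∨ qs l.succ = (A (idx l)).1.2)

/-- The gates with indices `lo ≤ i < hi` of `A` form a causal slice. -/
def IsCausalSlice {n R : ℕ} (A : Architecture n R) (lo hi : ℕ) : Prop :=
  ∃ t, IsCausalSliceWith A lo hi t

/-! ## Group, topological, measurable and compactness structure on `SU(4)`,
and its Haar probability measure -/

namespace SU4

theorem star_mem {U : Matrix (Fin 4) (Fin 4) ℂ}
    (hU : U ∈ Matrix.specialUnitaryGroup (Fin 4) ℂ) :
    star U ∈ Matrix.specialUnitaryGroup (Fin 4) ℂ := by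
  rw [Matrix.mem_specialUnitaryGroup_iff] at hU ⊢
  refine ⟨Unitary.star_mem hU.1, ?_⟩
  have : (star U).det = star U.det := by
    simp [Matrix.star_eq_conjTranspose, Matrix.det_conjTranspose]
  rw [this, hU.2]
  simp

noncomputable instance : Group SU4 :=
  { (inferInstance : Monoid SU4) with
    inv := fun U => ⟨star U.1, star_mem U.2⟩
    inv_mul_cancel := fun U => Subtype.ext <| by
      have h := (Matrix.mem_specialUnitaryGroup_iff.mp U.2).1.1
      simpa using h }

instance : IsTopologicalGroup SU4 where
  continuous_mul := by
    apply Continuous.subtype_mk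
    exact ((continuous_subtype_val.comp continuous_fst).matrix_mul
      (continuous_subtype_val.comp continuous_snd))
  continuous_inv := by
    apply Continuous.subtype_mk
    exact continuous_star.comp continuous_subtype_val

noncomputable instance : MeasurableSpace (Matrix (Fin 4) (Fin 4) ℂ) :=
  inferInstanceAs (MeasurableSpace (Fin 4 → Fin 4 → ℂ))

instance : BorelSpace (Matrix (Fin 4) (Fin 4) ℂ) :=
  inferInstanceAs (BorelSpace (Fin 4 → Fin 4 → ℂ))

theorem isClosed :
    IsClosed (Matrix.specialUnitaryGroup (Fin 4) ℂ : Set (Matrix (Fin 4) (Fin 4) ℂ)) := by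
  have h1 : IsClosed {M : Matrix (Fin 4) (Fin 4) ℂ | star M * M = 1} :=
    isClosed_eq ((continuous_id.matrix_conjTranspose).matrix_mul continuous_id) continuous_const
  have h2 : IsClosed {M : Matrix (Fin 4) (Fin 4) ℂ | M * star M = 1} :=
    isClosed_eq (continuous_id.matrix_mul (continuous_id.matrix_conjTranspose)) continuous_const
  have h3 : IsClosed {M : Matrix (Fin 4) (Fin 4) ℂ | M.det = 1} :=
    isClosed_eq continuous_id.matrix_det continuous_const
  have : (Matrix.specialUnitaryGroup (Fin 4) ℂ : Set (Matrix (Fin 4) (Fin 4) ℂ)) =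
      ({M | star M * M = 1} ∩ {M | M * star M = 1}) ∩ {M | M.det = 1} := by
    ext M
    simp only [SetLike.mem_coe, Matrix.mem_specialUnitaryGroup_iff, Unitary.mem_iff,
      Set.mem_inter_iff, Set.mem_setOf_eq]
  rw [this]
  exact ((h1.inter h2)).inter h3

theorem isCompact :
    IsCompact (Matrix.specialUnitaryGroup (Fin 4) ℂ : Set (Matrix (Fin 4) (Fin 4) ℂ)) := by
  have hK : IsCompact (Set.pi Set.univ fun _ : Fin 4 => Set.pi Set.univ fun _ : Fin 4 =>
      Metric.closedBall (0 : ℂ) 1 : Set (Matrix (Fin 4) (Fin 4) ℂ)) :=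
    isCompact_univ_pi fun _ => isCompact_univ_pi fun _ => isCompact_closedBall _ _
  refine IsCompact.of_isClosed_subset hK isClosed ?_
  intro M hM
  refine fun i _ => fun j _ => ?_
  simp only [Metric.mem_closedBall, dist_zero_right]
  exact entry_norm_bound_of_unitary (Matrix.mem_specialUnitaryGroup_iff.mp hM).1 i j

instance : CompactSpace SU4 :=
  isCompact_iff_compactSpace.mp isCompact

noncomputable instance : MeasurableSpace SU4 := borel SU4

instance : BorelSpace SU4 := ⟨rfl⟩

end SU4

/-- The Haar probability measure on `SU(4)`. -/
noncomputable def haarSU4 : Measure SU4 :=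
  Measure.haarMeasure ⟨⟨Set.univ, isCompact_univ⟩, by simp⟩

instance : IsProbabilityMeasure haarSU4 := by
  constructor
  have h : Measure.haarMeasure
      (⟨⟨Set.univ, isCompact_univ⟩, by simp⟩ : TopologicalSpace.PositiveCompacts SU4)
      (⟨⟨Set.univ, isCompact_univ⟩, by simp⟩ : TopologicalSpace.PositiveCompacts SU4) = 1 :=
    Measure.haarMeasure_self
  simpa [haarSU4] using h

/-- The product of Haar probability measures on `SU(4)^{×R}`: the distribution of a random
quantum circuit with `R` gates in a fixed architecture. -/
noncomputable def muSU4 (R : ℕ) : Measure (Fin R → SU4) :=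
  Measure.pi fun _ => haarSU4

/-! ## The differential of the contraction map, its rank, and the accessible dimension -/

/-- The Lie algebra `su(m)` of traceless skew-Hermitian matrices, as a real subspace. -/
noncomputable def suAlgebra (m : Type*) [Fintype m] [DecidableEq m] :
    Submodule ℝ (Matrix m m ℂ) :=
  Submodule.span ℝ {H | Hᴴ = -H ∧ H.trace = 0}

/-- `embedGate` as a real-linear map in the gate entry. -/
noncomputable def embedLin {n : ℕ} (p : Fin n × Fin n) :
    Matrix (Fin 4) (Fin 4) ℂ →ₗ[ℝ] NMatrix n where
  toFun := embedGate p
  map_add' u v := by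
    funext a b
    simp only [embedGate, Matrix.add_apply]
    split <;> simp
  map_smul' r u := by
    funext a b
    simp only [embedGate, Matrix.smul_apply, RingHom.id_apply]
    split <;> simp

/-- The differential of the contraction map `F^A` at the point `x ∈ SU(4)^{×R}`, read in the
exponential charts: the direction `(H_1, …, H_R)` is mapped to
`∑_j (U_R)_{p_R} ⋯ (U_{j+1})_{p_{j+1}} · (H_j)_{p_j} · (U_j)_{p_j} ⋯ (U_1)_{p_1}`. -/
noncomputable def contractDiff {n R : ℕ} (A : Architecture n R) (x : Fin R → SU4) :
    (Fin R → Matrix (Fin 4) (Fin 4) ℂ) →ₗ[ℝ] NMatrix n :=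
  ∑ j : Fin R,
    (LinearMap.mulLeft ℝ (((gateList A x).drop (j + 1)).reverse.prod)) ∘ₗ
      (LinearMap.mulRight ℝ
        (embedGate (A j).1 (x j : Matrix (Fin 4) (Fin 4) ℂ) *
          ((gateList A x).take j).reverse.prod)) ∘ₗ
      (embedLin (A j).1) ∘ₗ
      (LinearMap.proj j)

/-- The rank of (the differential of) the contraction map `F^A` at `x`: the dimension of
the image, under the differential, of the tangent space `su(4)^{×R}`. -/
noncomputable def rankAt {n R : ℕ} (A : Architecture n R) (x : Fin R → SU4) : ℕ :=
  Module.finrank ℝ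
    ↥(Submodule.map (contractDiff A x) (Submodule.pi Set.univ fun _ => suAlgebra (Fin 4)))

/-- The maximal rank `r_max` of the contraction map `F^A` over all points of `SU(4)^{×R}`. -/
noncomputable def rmax {n R : ℕ} (A : Architecture n R) : ℕ := ⨆ x, rankAt A x

/-- A matrix viewed as a point of the Euclidean (Frobenius) space of its entries. -/
noncomputable def toEuc {n : ℕ} (M : NMatrix n) :
    EuclideanSpace ℂ (QubitBasis n × QubitBasis n) := WithLp.toLp 2 fun p => M p.1 p.2

/-- The Frobenius norm `‖X‖_F = (tr (X† X))^{1/2}` of an `n`-qubit matrix. -/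
noncomputable def frobNorm {n : ℕ} (M : NMatrix n) : ℝ := ‖toEuc M‖

/-- The accessible dimension `d_A` of an architecture `A`: the Hausdorff dimension of the
set `U(A)` of unitaries implementable with `A`, with respect to the Frobenius metric. -/
noncomputable def accessibleDim {n R : ℕ} (A : Architecture n R) : ℝ≥0∞ :=
  dimH (toEuc '' Set.range (contract A))

/-! ## Pauli strings and Clifford gates -/

/-- The Pauli matrices `1, X, Y, Z`. -/
noncomputable def pauli : Fin 4 → Matrix (Fin 2) (Fin 2) ℂ
  | 0 => 1
  | 1 => !![0, 1; 1, 0]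
  | 2 => !![0, -Complex.I; Complex.I, 0]
  | 3 => !![1, 0; 0, -1]

/-- The `n`-qubit Pauli string `⨂ᵢ pauli (s i)`. -/
noncomputable def pauliString {n : ℕ} (s : Fin n → Fin 4) : NMatrix n :=
  fun a b => ∏ i, pauli (s i) (a i) (b i)

/-- A two-qubit Pauli string, as a `4 × 4` matrix. -/
noncomputable def pauli2 (s : Fin 2 → Fin 4) : Matrix (Fin 4) (Fin 4) ℂ :=
  fun a b =>
    pauli (s 0) ⟨a.val / 2, by have := a.isLt; omega⟩ ⟨b.val / 2, by have := b.isLt; omega⟩ *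
    pauli (s 1) ⟨a.val % 2, by have := a.isLt; omega⟩ ⟨b.val % 2, by have := b.isLt; omega⟩

/-- A two-qubit gate is Clifford if it maps every Pauli string to a scalar multiple of a
Pauli string under conjugation. -/
def IsCliffordGate (u : Matrix (Fin 4) (Fin 4) ℂ) : Prop :=
  ∀ s : Fin 2 → Fin 4, ∃ (c : ℂ) (s' : Fin 2 → Fin 4),
    u * pauli2 s * uᴴ = c • pauli2 s'

/-- Application to the state `|0^n⟩`, `M ↦ M |0^n⟩`, as a real-linear map. -/
noncomputable def mulVecKet0 (n : ℕ) : NMatrix n →ₗ[ℝ] (QubitBasis n → ℂ) where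
  toFun M := M *ᵥ ket0 n
  map_add' M N := Matrix.add_mulVec M N (ket0 n)
  map_smul' r M := by
    simp only [RingHom.id_apply]
    exact Matrix.smul_mulVec r M (ket0 n)

/-- The rank of (the differential of) the map `G^A : x ↦ F^A(x)|0^n⟩` at `x`. -/
noncomputable def stateRankAt {n R : ℕ} (A : Architecture n R) (x : Fin R → SU4) : ℕ :=
  Module.finrank ℝ
    ↥(Submodule.map ((mulVecKet0 n) ∘ₗ contractDiff A x)
      (Submodule.pi Set.univ fun _ => suAlgebra (Fin 4)))

/-! ## Trace norm and operator norm -/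

/-- The positive semidefinite square root of a positive semidefinite matrix
(Mathlib's former `Matrix.PosSemidef.sqrt`). -/
noncomputable def Matrix.PosSemidef.sqrt {m 𝕜 : Type*} [Fintype m] [RCLike 𝕜] [DecidableEq m]
    {A : Matrix m m 𝕜} (hA : A.PosSemidef) : Matrix m m 𝕜 :=
  hA.1.eigenvectorUnitary.1 * Matrix.diagonal ((↑) ∘ Real.sqrt ∘ hA.1.eigenvalues) *
    (star hA.1.eigenvectorUnitary : Matrix m m 𝕜)

/-- The trace norm `‖M‖₁ = tr ((M† M)^{1/2})` of a square complex matrix. -/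
noncomputable def traceNorm {m : Type*} [Fintype m] [DecidableEq m] (M : Matrix m m ℂ) : ℝ :=
  ((Matrix.posSemidef_conjTranspose_mul_self M).sqrt.trace).re

/-- The operator norm (largest singular value) of a square complex matrix: the norm of the
induced operator between Euclidean spaces. -/
noncomputable def opNorm {m : Type*} [Fintype m] [DecidableEq m] (M : Matrix m m ℂ) : ℝ :=
  ‖LinearMap.toContinuousLinearMap (Matrix.toEuclideanLin M)‖

/-! ## The uniform measure on a finite index set -/

/-- The uniform probability measure on `Fin m`. -/
noncomputable def uniformFin (m : ℕ) : Measure (Fin m) :=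
  ((m : ℝ≥0∞))⁻¹ • Measure.count

instance (m : ℕ) : IsFiniteMeasure (uniformFin m) := by
  constructor
  rw [uniformFin, Measure.smul_apply, smul_eq_mul, Measure.count_univ,
    ENat.card_eq_coe_fintype_card, Fintype.card_fin, ENat.toENNReal_coe]
  rcases Nat.eq_zero_or_pos m with h | h
  · simp [h]
  · rw [ENNReal.inv_mul_cancel (by exact_mod_cast h.ne') (by simp)]
    exact ENNReal.one_lt_top

/-! ## Statement 14: linear complexity growth for the brickwork architecture -/

/-- The `n`-qubit brickwork architecture with `T` blocks of `2n` alternating layers each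
(`L = n(n−1)` gates per block, `R = T·n(n−1)` gates in total).  Within each repeating pair of
layers, the first `n/2` gates act at the (0-indexed) pairs `(0,1), (2,3), …, (n−2,n−1)` and
the next `n/2 − 1` gates act at the pairs `(1,2), (3,4), …, (n−3,n−2)`. -/
def brickwork (n T : ℕ) (hn : 2 ≤ n) (he : n % 2 = 0) :
    Architecture n (T * (n * (n - 1))) := fun i =>
  if hm : (i : ℕ) % (n - 1) < n / 2 then
    ⟨(⟨2 * ((i : ℕ) % (n - 1)), by have := Nat.mod_lt (i : ℕ) (y := n - 1) (by omega); omega⟩,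
      ⟨2 * ((i : ℕ) % (n - 1)) + 1,
        by have := Nat.mod_lt (i : ℕ) (y := n - 1) (by omega); omega⟩),
      Fin.ne_of_val_ne (by
        show 2 * ((i : ℕ) % (n - 1)) ≠ 2 * ((i : ℕ) % (n - 1)) + 1; omega)⟩
  else
    ⟨(⟨2 * ((i : ℕ) % (n - 1)) - n + 1,
        by have := Nat.mod_lt (i : ℕ) (y := n - 1) (by omega); omega⟩,
      ⟨2 * ((i : ℕ) % (n - 1)) - n + 2,
        by have := Nat.mod_lt (i : ℕ) (y := n - 1) (by omega); omega⟩),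
      Fin.ne_of_val_ne (by
        show 2 * ((i : ℕ) % (n - 1)) - n + 1 ≠ 2 * ((i : ℕ) % (n - 1)) - n + 2; omega)⟩


namespace BW

abbrev M4 := Matrix (Fin 4) (Fin 4) ℂ
abbrev M2 := Matrix (Fin 2) (Fin 2) ℂ

/-- set the two entries at `p` -/
def upd {n : ℕ} {α : Type*} (p : Fin n × Fin n) (a : Fin n → α) (i j : α) : Fin n → α :=
  Function.update (Function.update a p.1 i) p.2 j

section upd
variable {n : ℕ} {α : Type*} {p : Fin n × Fin n} (a : Fin n → α) (i j : α)
@[simp] theorem upd_fst (hp : p.1 ≠ p.2) (a : Fin n → α) (i j : α) : upd p a i j p.1 = i := by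
  simp [upd, Function.update_of_ne hp]
@[simp] theorem upd_snd : upd p a i j p.2 = j := by
  simp [upd]
theorem upd_of_ne {q : Fin n} (h1 : q ≠ p.1) (h2 : q ≠ p.2) : upd p a i j q = a q := by
  simp [upd, h1, h2]
end upd

theorem pairIdx_surj (k : Fin 4) : ∃ i j, pairIdx i j = k := by
  revert k; decide

theorem sum_pairIdx {β : Type*} [AddCommMonoid β] (f : Fin 4 → β) :
    ∑ k, f k = ∑ i, ∑ j, f (pairIdx i j) := by
  simp [Fin.sum_univ_four, Fin.sum_univ_two, pairIdx, add_assoc]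

theorem pairIdx_inj {i j k l : Fin 2} (h : pairIdx i j = pairIdx k l) : i = k ∧ j = l := by
  revert i j k l; decide

theorem sum_agree {n : ℕ} {p : Fin n × Fin n} (hp : p.1 ≠ p.2) (a : QubitBasis n)
    (g : QubitBasis n → ℂ) :
    ∑ c : QubitBasis n, (if (∀ i, i ≠ p.1 → i ≠ p.2 → a i = c i) then g c else 0) =
      ∑ i, ∑ j, g (upd p a i j) := by
  rw [← Fintype.sum_prod_type', ← Finset.sum_filter]
  symm
  refine Finset.sum_bij (fun (ij : Fin 2 × Fin 2) _ => upd p a ij.1 ij.2) ?_ ?_ ?_ ?_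
  · intro ij _
    simp only [Finset.mem_filter, Finset.mem_univ, true_and]
    intro i h1 h2
    rw [upd_of_ne _ _ _ h1 h2]
  · intro x _ y _ h
    have h1 := congrFun h p.1
    have h2 := congrFun h p.2
    simp only [upd_fst hp, upd_snd] at h1 h2
    exact Prod.ext h1 h2
  · intro c hc
    simp only [Finset.mem_filter, Finset.mem_univ, true_and] at hc
    refine ⟨(c p.1, c p.2), Finset.mem_univ _, ?_⟩
    funext q
    by_cases h1 : q = p.1
    · subst h1; simp [upd_fst hp]
    by_cases h2 : q = p.2
    · subst h2; simp
    rw [upd_of_ne _ _ _ h1 h2, hc q h1 h2]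
  · intro _ _; rfl

theorem embed_mul_apply {n : ℕ} {p : Fin n × Fin n} (hp : p.1 ≠ p.2) (u : M4) (M : NMatrix n)
    (a b : QubitBasis n) :
    (embedGate p u * M) a b =
      ∑ i, ∑ j, u (pairIdx (a p.1) (a p.2)) (pairIdx i j) * M (upd p a i j) b := by
  rw [Matrix.mul_apply]
  simp only [embedGate, ite_mul, zero_mul]
  rw [sum_agree hp a (fun c => u (pairIdx (a p.1) (a p.2)) (pairIdx (c p.1) (c p.2)) * M c b)]
  simp [upd_fst hp]

theorem mul_embed_apply {n : ℕ} {p : Fin n × Fin n} (hp : p.1 ≠ p.2) (u : M4) (M : NMatrix n)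
    (a b : QubitBasis n) :
    (M * embedGate p u) a b =
      ∑ i, ∑ j, M a (upd p b i j) * u (pairIdx i j) (pairIdx (b p.1) (b p.2)) := by
  rw [Matrix.mul_apply]
  simp only [embedGate, mul_ite, mul_zero]
  have := sum_agree hp b (fun c => M a c * u (pairIdx (c p.1) (c p.2)) (pairIdx (b p.1) (b p.2)))
  simp only [upd_fst hp, upd_snd] at this
  rw [← this]
  refine Finset.sum_congr rfl fun c _ => ?_
  congr 1
  simp only [eq_comm]

theorem embed_mul {n : ℕ} {p : Fin n × Fin n} (hp : p.1 ≠ p.2) (u v : M4) :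
    embedGate p (u * v) = embedGate p u * embedGate p v := by
  ext a b
  rw [embed_mul_apply hp]
  simp only [embedGate, upd_fst hp, upd_snd, Matrix.mul_apply]
  have : ∀ i j, (∀ q, q ≠ p.1 → q ≠ p.2 → upd p a i j q = b q) ↔
      (∀ q, q ≠ p.1 → q ≠ p.2 → a q = b q) := by
    intro i j
    refine forall_congr' fun q => forall_congr' fun h1 => forall_congr' fun h2 => ?_
    rw [upd_of_ne _ _ _ h1 h2]
  simp only [this]
  split_ifs
  · rw [sum_pairIdx]
  · simp

theorem embed_one {n : ℕ} {p : Fin n × Fin n} : embedGate p (1 : M4) = (1 : NMatrix n) := by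
  ext a b
  simp only [embedGate, Matrix.one_apply]
  by_cases hab : a = b
  · subst hab; simp
  · rw [if_neg hab]
    split_ifs with h1 h2
    · exfalso; apply hab; funext q
      have := pairIdx_inj h2
      by_cases e1 : q = p.1
      · rw [e1]; exact this.1
      by_cases e2 : q = p.2
      · rw [e2]; exact this.2
      exact h1 q e1 e2
    · rfl
    · rfl

theorem embed_star {n : ℕ} {p : Fin n × Fin n} (u : M4) :
    embedGate p (star u) = star (embedGate p u) := by
  ext a b
  simp only [embedGate, Matrix.star_apply]
  by_cases h : ∀ i, i ≠ p.1 → i ≠ p.2 → a i = b i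
  · rw [if_pos h, if_pos (fun i h1 h2 => (h i h1 h2).symm)]
  · rw [if_neg h, if_neg (fun h' => h fun i h1 h2 => (h' i h1 h2).symm)]; simp

/-- tensor product of one-qubit matrices -/
noncomputable def locM {n : ℕ} (κ : Fin n → M2) : NMatrix n := fun a b => ∏ i, κ i (a i) (b i)

theorem locM_mul {n : ℕ} (κ κ' : Fin n → M2) : locM κ * locM κ' = locM (fun i => κ i * κ' i) := by
  ext a b
  simp only [locM, Matrix.mul_apply, Finset.prod_univ_sum, Fintype.piFinset_univ,
    Finset.prod_mul_distrib]

theorem locM_one {n : ℕ} : locM (fun _ : Fin n => (1 : M2)) = 1 := by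
  ext a b
  simp only [locM, Matrix.one_apply]
  by_cases hab : a = b
  · subst hab; simp
  · rw [if_neg hab]
    obtain ⟨i, hi⟩ := Function.ne_iff.mp hab
    exact Finset.prod_eq_zero (Finset.mem_univ i) (if_neg hi)

/-- two-qubit product matrix -/
noncomputable def kron2 (k l : M2) : M4 := fun a b =>
    k ⟨a.val / 2, by have := a.isLt; omega⟩ ⟨b.val / 2, by have := b.isLt; omega⟩ *
    l ⟨a.val % 2, by have := a.isLt; omega⟩ ⟨b.val % 2, by have := b.isLt; omega⟩

theorem kron2_apply (k l : M2) (i j i' j' : Fin 2) :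
    kron2 k l (pairIdx i j) (pairIdx i' j') = k i i' * l j j' := by
  have e1 : ∀ i j : Fin 2, (⟨(pairIdx i j).val / 2, by have := (pairIdx i j).isLt; omega⟩ : Fin 2) = i := by
    decide
  have e2 : ∀ i j : Fin 2, (⟨(pairIdx i j).val % 2, by have := (pairIdx i j).isLt; omega⟩ : Fin 2) = j := by
    decide
  simp only [kron2, e1, e2]

theorem M4_ext {u v : M4} (h : ∀ i j k l, u (pairIdx i j) (pairIdx k l) = v (pairIdx i j) (pairIdx k l)) :
    u = v := by
  ext a b
  obtain ⟨i, j, rfl⟩ := pairIdx_surj a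
  obtain ⟨k, l, rfl⟩ := pairIdx_surj b
  exact h i j k l

theorem kron2_mul (k l k' l' : M2) : kron2 k l * kron2 k' l' = kron2 (k * k') (l * l') := by
  apply M4_ext
  intro i j i' j'
  rw [Matrix.mul_apply, sum_pairIdx]
  simp only [kron2_apply, Matrix.mul_apply, Fin.sum_univ_two]
  ring

theorem kron2_one : kron2 1 1 = 1 := by
  apply M4_ext
  intro i j i' j'
  rw [kron2_apply]
  revert i j i' j'
  simp only [Matrix.one_apply]
  intro i j i' j'
  by_cases h1 : i = i' <;> by_cases h2 : j = j'
  · simp [h1, h2]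
  · have : pairIdx i j ≠ pairIdx i' j' := fun h => h2 (pairIdx_inj h).2
    simp [h2, this]
  · have : pairIdx i j ≠ pairIdx i' j' := fun h => h1 (pairIdx_inj h).1
    simp [h1, this]
  · have : pairIdx i j ≠ pairIdx i' j' := fun h => h1 (pairIdx_inj h).1
    simp [h1, this]

theorem kron2_star (k l : M2) : star (kron2 k l) = kron2 (star k) (star l) := by
  apply M4_ext
  intro i j i' j'
  simp [Matrix.star_apply, kron2_apply, mul_comm]

theorem kron2_trace (k l : M2) : (kron2 k l).trace = k.trace * l.trace := by
  rw [Matrix.trace, sum_pairIdx]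
  simp only [Matrix.diag, kron2_apply, Matrix.trace, Finset.sum_mul_sum]

/-- splitting the product over the qubits in the two of `p` and the others -/
theorem prod_split {n : ℕ} {p : Fin n × Fin n} (hp : p.1 ≠ p.2) (f : Fin n → ℂ) :
    ∏ i, f i = f p.1 * f p.2 * ∏ i ∈ (Finset.univ.erase p.1).erase p.2, f i := by
  rw [mul_assoc, Finset.mul_prod_erase _ _ (by simp [hp.symm]),
    Finset.mul_prod_erase _ _ (Finset.mem_univ _)]

theorem locM_split {n : ℕ} {p : Fin n × Fin n} (hp : p.1 ≠ p.2) (κ : Fin n → M2) (k l : M2) :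
    locM (upd p κ k l) = embedGate p (kron2 k l) * locM (upd p κ 1 1) := by
  ext a b
  rw [embed_mul_apply hp]
  simp only [locM, kron2_apply]
  simp only [prod_split hp, upd_fst hp, upd_snd]
  have e : ∀ (κ : Fin n → M2) (a b : QubitBasis n) (k l : M2) (i j : Fin 2),
      ∏ q ∈ (Finset.univ.erase p.1).erase p.2, upd p κ k l q (upd p a i j q) (b q) =
      ∏ q ∈ (Finset.univ.erase p.1).erase p.2, κ q (a q) (b q) := by
    intro κ a b k l i j
    refine Finset.prod_congr rfl fun q hq => ?_
    simp only [Finset.mem_erase, Finset.mem_univ, and_true] at hq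
    rw [upd_of_ne _ _ _ hq.2 hq.1, upd_of_ne _ _ _ hq.2 hq.1]
  have e' : ∏ q ∈ (Finset.univ.erase p.1).erase p.2, upd p κ k l q (a q) (b q) =
      ∏ q ∈ (Finset.univ.erase p.1).erase p.2, κ q (a q) (b q) := by
    refine Finset.prod_congr rfl fun q hq => ?_
    simp only [Finset.mem_erase, Finset.mem_univ, and_true] at hq
    rw [upd_of_ne _ _ _ hq.2 hq.1]
  simp only [e, e', Matrix.one_apply]
  have h0 : ∀ (x : ℂ) (i0 : Fin 2), x = x := fun _ _ => rfl
  generalize ∏ q ∈ (Finset.univ.erase p.1).erase p.2, κ q (a q) (b q) = c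
  simp only [← mul_assoc, mul_ite, mul_one, mul_zero, ite_mul, zero_mul]
  simp [Finset.sum_ite_eq']

theorem locM_comm {n : ℕ} {p : Fin n × Fin n} (hp : p.1 ≠ p.2) (κ : Fin n → M2) (u : M4) :
    embedGate p u * locM (upd p κ 1 1) = locM (upd p κ 1 1) * embedGate p u := by
  ext a b
  rw [embed_mul_apply hp, mul_embed_apply hp]
  simp only [locM]
  simp only [prod_split hp, upd_fst hp, upd_snd]
  have e : ∀ (κ : Fin n → M2) (a b : QubitBasis n) (k l : M2) (i j : Fin 2),
      ∏ q ∈ (Finset.univ.erase p.1).erase p.2, upd p κ k l q (upd p a i j q) (b q) =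
      ∏ q ∈ (Finset.univ.erase p.1).erase p.2, κ q (a q) (b q) := by
    intro κ a b k l i j
    refine Finset.prod_congr rfl fun q hq => ?_
    simp only [Finset.mem_erase, Finset.mem_univ, and_true] at hq
    rw [upd_of_ne _ _ _ hq.2 hq.1, upd_of_ne _ _ _ hq.2 hq.1]
  have e' : ∀ (κ : Fin n → M2) (a b : QubitBasis n) (k l : M2) (i j : Fin 2),
      ∏ q ∈ (Finset.univ.erase p.1).erase p.2, upd p κ k l q (a q) (upd p b i j q) =
      ∏ q ∈ (Finset.univ.erase p.1).erase p.2, κ q (a q) (b q) := by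
    intro κ a b k l i j
    refine Finset.prod_congr rfl fun q hq => ?_
    simp only [Finset.mem_erase, Finset.mem_univ, and_true] at hq
    rw [upd_of_ne _ _ _ hq.2 hq.1, upd_of_ne _ _ _ hq.2 hq.1]
  simp only [e, e', Matrix.one_apply]
  generalize ∏ q ∈ (Finset.univ.erase p.1).erase p.2, κ q (a q) (b q) = c
  simp only [mul_ite, mul_one, mul_zero, ite_mul, zero_mul, one_mul]
  simp [Finset.sum_ite_eq, Finset.sum_ite_eq', mul_comm]

theorem upd_self {n : ℕ} {α : Type*} {p : Fin n × Fin n} (κ : Fin n → α) :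
    upd p κ (κ p.1) (κ p.2) = κ := by
  funext q
  simp only [upd]
  by_cases h2 : q = p.2
  · subst h2; simp
  by_cases h1 : q = p.1
  · subst h1; simp [h2]
  simp [h1, h2]

theorem upd_upd {n : ℕ} {α : Type*} {p : Fin n × Fin n} (κ : Fin n → α) (i j k l : α) :
    upd p (upd p κ i j) k l = upd p κ k l := by
  funext q
  by_cases h2 : q = p.2
  · subst h2; simp
  by_cases h1 : q = p.1
  · subst h1; simp [h2, upd]
  simp [h1, h2, upd]

/-- conjugation of a product matrix by a two-qubit gate -/
theorem conj_locM {n : ℕ} {p : Fin n × Fin n} (hp : p.1 ≠ p.2) (κ : Fin n → M2) (u v : M4)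
    (k l : M2) (h : u * kron2 (κ p.1) (κ p.2) * v = kron2 k l) :
    embedGate p u * locM κ * embedGate p v = locM (upd p κ k l) := by
  conv_lhs => rw [← upd_self (p := p) κ, locM_split hp]
  rw [mul_assoc, mul_assoc, ← locM_comm hp, locM_split hp κ k l, ← h, embed_mul hp, embed_mul hp]
  simp only [mul_assoc]

end BW


namespace BW

theorem pauli_star (a : Fin 4) : star (pauli a) = pauli a := by
  fin_cases a <;> ext i j <;> fin_cases i <;> fin_cases j <;> simp [pauli, Matrix.star_apply]

theorem pauli_sq (a : Fin 4) : pauli a * pauli a = 1 := by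
  fin_cases a <;> ext i j <;> fin_cases i <;> fin_cases j <;>
    simp [pauli, Matrix.mul_apply, Fin.sum_univ_two]

theorem pauli_anti {a b : Fin 4} (ha : a ≠ 0) (hb : b ≠ 0) (hab : a ≠ b) :
    pauli a * pauli b = - (pauli b * pauli a) := by
  fin_cases a <;> fin_cases b <;> simp at ha hb hab <;>
  ext i j <;> fin_cases i <;> fin_cases j <;>
    simp [pauli, Matrix.mul_apply, Fin.sum_univ_two]

theorem pauli_trace (a b : Fin 4) : (pauli a * pauli b).trace = if a = b then 2 else 0 := by
  fin_cases a <;> fin_cases b <;>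
    simp [pauli, Matrix.mul_apply, Fin.sum_univ_two, Matrix.trace] <;> norm_num

theorem pauli_zero : pauli 0 = 1 := rfl

theorem pauli_trace' {a : Fin 4} (ha : a ≠ 0) : (pauli a).trace = 0 := by
  have := pauli_trace a 0
  rw [pauli_zero, mul_one, if_neg ha] at this
  exact this

theorem exists_scale (w : M4) (hw : w * star w = 1) :
    ∃ u ∈ Matrix.specialUnitaryGroup (Fin 4) ℂ, ∀ M : M4, u * M * star u = w * M * star w := by
  have hdet : w.det * star w.det = 1 := by
    have := congrArg Matrix.det hw
    rw [Matrix.det_mul, Matrix.star_eq_conjTranspose, Matrix.det_conjTranspose] at this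
    simpa using this
  obtain ⟨c, hc⟩ := IsAlgClosed.exists_pow_nat_eq (star w.det) (n := 4) (by norm_num)
  have hcn : ‖c‖ = 1 := by
    have h1 : ‖w.det‖ * ‖w.det‖ = 1 := by
      have := congrArg norm hdet
      simpa using this
    have h2 : ‖w.det‖ = 1 := by nlinarith [norm_nonneg w.det]
    have h3 : ‖c‖ ^ 4 = 1 := by rw [← norm_pow, hc]; simpa using h2
    exact (pow_eq_one_iff_of_nonneg (norm_nonneg c) (by norm_num)).mp h3
  have hcc : c * star c = 1 := by
    have := Complex.mul_conj' c
    rw [hcn] at this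
    simpa using this
  refine ⟨c • w, ?_, ?_⟩
  · rw [Matrix.mem_specialUnitaryGroup_iff, Matrix.mem_unitaryGroup_iff]
    constructor
    · rw [star_smul, smul_mul_smul_comm, hw, hcc, one_smul]
    · rw [Matrix.det_smul, Fintype.card_fin, hc, mul_comm]; exact hdet
  · intro M
    rw [star_smul, smul_mul_assoc, smul_mul_smul_comm, hcc, one_smul]

theorem exists_conj_of_anti (σ τ : M4) (hσ : star σ = σ) (hτ : star τ = τ) (hσ2 : σ * σ = 1)
    (hτ2 : τ * τ = 1) (h : σ * τ = - (τ * σ)) :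
    ∃ u ∈ Matrix.specialUnitaryGroup (Fin 4) ℂ, u * σ * star u = τ := by
  have hr : ((Real.sqrt 2)⁻¹ : ℝ) * ((Real.sqrt 2)⁻¹ : ℝ) = 1 / 2 := by
    rw [← mul_inv, Real.mul_self_sqrt (by norm_num)]; norm_num
  set r : ℝ := (Real.sqrt 2)⁻¹
  have hws : star (r • (σ + τ)) = r • (σ + τ) := by
    simp [star_smul, hσ, hτ]
  have hw2 : (r • (σ + τ)) * (r • (σ + τ)) = 1 := by
    rw [smul_mul_smul_comm, hr]
    have : (σ + τ) * (σ + τ) = (2 : ℝ) • (1 : M4) := by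
      rw [add_mul, mul_add, mul_add, hσ2, hτ2, h, two_smul]; abel
    rw [this, smul_smul]; norm_num
  obtain ⟨u, hu, hc⟩ := exists_scale (r • (σ + τ)) (by rw [hws, hw2])
  refine ⟨u, hu, ?_⟩
  rw [hc, hws]
  have : (r • (σ + τ)) * σ = τ * (r • (σ + τ)) := by
    rw [smul_mul_assoc, mul_smul_comm, add_mul, mul_add, hσ2, hτ2, add_comm]
  rw [this, mul_assoc, hw2, mul_one]

theorem kron2_neg (k l : M2) : kron2 k (-l) = - kron2 k l := by
  apply M4_ext
  intro i j i' j'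
  simp [kron2_apply]

theorem kron2_neg' (k l : M2) : kron2 (-k) l = - kron2 k l := by
  apply M4_ext
  intro i j i' j'
  simp [kron2_apply]

theorem conj_trans {σ τ ρ : M4} 
    (h1 : ∃ u ∈ Matrix.specialUnitaryGroup (Fin 4) ℂ, u * σ * star u = τ)
    (h2 : ∃ u ∈ Matrix.specialUnitaryGroup (Fin 4) ℂ, u * τ * star u = ρ) :
    ∃ u ∈ Matrix.specialUnitaryGroup (Fin 4) ℂ, u * σ * star u = ρ := by
  obtain ⟨u, hu, h1⟩ := h1
  obtain ⟨v, hv, h2⟩ := h2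
  refine ⟨v * u, mul_mem hv hu, ?_⟩
  rw [star_mul, ← h2, ← h1]
  simp only [mul_assoc]

theorem exists_ne (b : Fin 4) : ∃ b' : Fin 4, b' ≠ 0 ∧ b' ≠ b := by
  revert b; decide

theorem pauli_move_aux {a b : Fin 4} (hb : b ≠ 0) : ∃ b' : Fin 4, b' ≠ 0 ∧
    ∃ u ∈ Matrix.specialUnitaryGroup (Fin 4) ℂ,
      u * kron2 (pauli a) (pauli b) * star u = kron2 (pauli 0) (pauli b') := by
  obtain ⟨b', h0, hb'⟩ := exists_ne b
  refine ⟨b', h0, exists_conj_of_anti _ _ ?_ ?_ ?_ ?_ ?_⟩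
  · rw [kron2_star, pauli_star, pauli_star]
  · rw [kron2_star, pauli_star, pauli_star]
  · rw [kron2_mul, pauli_sq, pauli_sq, kron2_one]
  · rw [kron2_mul, pauli_sq, pauli_sq, kron2_one]
  · rw [kron2_mul, kron2_mul, pauli_anti hb h0 (Ne.symm hb'), kron2_neg, pauli_zero, one_mul, mul_one]

theorem pauli_move {a b : Fin 4} (h : ¬ (a = 0 ∧ b = 0)) : ∃ b' : Fin 4, b' ≠ 0 ∧
    ∃ u ∈ Matrix.specialUnitaryGroup (Fin 4) ℂ,
      u * kron2 (pauli a) (pauli b) * star u = kron2 (pauli 0) (pauli b') := by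
  by_cases hb : b = 0
  · have ha : a ≠ 0 := fun ha => h ⟨ha, hb⟩
    subst hb
    obtain ⟨a', h0, ha'⟩ := exists_ne a
    obtain ⟨b', hb', hu⟩ := pauli_move_aux (a := a') (b := 3) (by decide)
    refine ⟨b', hb', conj_trans (exists_conj_of_anti _ _ ?_ ?_ ?_ ?_ ?_) hu⟩
    · rw [kron2_star, pauli_star, pauli_star]
    · rw [kron2_star, pauli_star, pauli_star]
    · rw [kron2_mul, pauli_sq, pauli_sq, kron2_one]
    · rw [kron2_mul, pauli_sq, pauli_sq, kron2_one]
    · rw [kron2_mul, kron2_mul, pauli_anti ha h0 (Ne.symm ha'), kron2_neg', pauli_zero, one_mul, mul_one]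
  · exact pauli_move_aux hb

/-- Pauli strings, as product matrices -/
noncomputable def PS {n : ℕ} (s : Fin n → Fin 4) : NMatrix n := locM (fun i => pauli (s i))

theorem locM_trace {n : ℕ} (κ : Fin n → M2) : (locM κ).trace = ∏ i, (κ i).trace := by
  simp only [locM, Matrix.trace, Matrix.diag, Finset.prod_univ_sum, Fintype.piFinset_univ]

theorem PS_trace {n : ℕ} (s t : Fin n → Fin 4) :
    (PS s * PS t).trace = if s = t then 2 ^ n else 0 := by
  rw [PS, PS, locM_mul, locM_trace]
  simp only [pauli_trace]
  split_ifs with h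
  · subst h; simp
  · obtain ⟨i, hi⟩ := Function.ne_iff.mp h
    exact Finset.prod_eq_zero (Finset.mem_univ i) (if_neg hi)

theorem PS_indep (n : ℕ) :
    LinearIndependent ℝ (fun s : Fin n → Fin 4 => (Complex.I • PS s : NMatrix n)) := by
  rw [Fintype.linearIndependent_iff]
  intro g hg t
  have h1 := congrArg (fun M : NMatrix n => (M * PS t).trace) hg
  simp only [Finset.sum_mul, Matrix.trace_sum, smul_mul_assoc, Matrix.trace_smul, PS_trace,
    zero_mul, Matrix.trace_zero] at h1
  simp only [smul_ite, smul_zero, Finset.sum_ite_eq', Finset.mem_univ, if_true] at h1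
  simpa using h1

theorem exists_PS_notMem {n : ℕ} (V : Submodule ℝ (NMatrix n))
    (hV : Module.finrank ℝ V < 4 ^ n - 1) :
    ∃ s : Fin n → Fin 4, s ≠ 0 ∧ (Complex.I • PS s : NMatrix n) ∉ V := by
  by_contra! hcon
  have hli := (PS_indep n).comp (fun s : {s : Fin n → Fin 4 // s ≠ 0} => s.1) Subtype.val_injective
  have h2 : LinearIndependent ℝ (fun s : {s : Fin n → Fin 4 // s ≠ 0} =>
      (⟨Complex.I • PS s.1, hcon s.1 s.2⟩ : V)) := by
    apply LinearIndependent.of_comp V.subtype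
    exact hli
  have h3 := h2.fintype_card_le_finrank
  have h4 : Fintype.card {s : Fin n → Fin 4 // s ≠ 0} = 4 ^ n - 1 := by
    rw [Fintype.card_subtype_compl]; simp
  omega

/-- conjugation as a real linear map -/
noncomputable def Ad {n : ℕ} (U : NMatrix n) : NMatrix n →ₗ[ℝ] NMatrix n :=
  LinearMap.mulLeft ℝ U ∘ₗ LinearMap.mulRight ℝ (star U)

theorem Ad_apply {n : ℕ} (U M : NMatrix n) : Ad U M = U * M * star U := by
  simp [Ad, mul_assoc]

theorem Ad_inj {n : ℕ} {U : NMatrix n} (h : star U * U = 1) : Function.Injective (Ad U) := by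
  intro M N hMN
  rw [Ad_apply, Ad_apply] at hMN
  have := congrArg (fun X => star U * X * U) hMN
  simp only [mul_assoc, h, mul_one] at this
  simpa only [← mul_assoc, h, one_mul] using this

/-- left-translated tangent space -/
noncomputable def Vsub {n : ℕ} (p : ℕ → Fin n × Fin n) (x : ℕ → M4) : ℕ → Submodule ℝ (NMatrix n)
  | 0 => ⊥
  | k + 1 => Submodule.map (embedLin (p k)) (suAlgebra (Fin 4)) ⊔
      Submodule.map (Ad (embedGate (p k) (x k))) (Vsub p x k)

theorem Vsub_congr {n : ℕ} (p : ℕ → Fin n × Fin n) {x y : ℕ → M4} (k : ℕ)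
    (h : ∀ j < k, x j = y j) : Vsub p x k = Vsub p y k := by
  induction k with
  | zero => rfl
  | succ k ih => rw [Vsub, Vsub, ih (fun j hj => h j (by omega)), h k (by omega)]

def Reach {n : ℕ} (p : ℕ → Fin n × Fin n) (k : ℕ) (W : Submodule ℝ (NMatrix n)) : Prop :=
  ∃ x : ℕ → SU4, W ≤ Vsub p (fun j => (x j : M4)) k

theorem Reach.step {n : ℕ} {p : ℕ → Fin n × Fin n} {k : ℕ} {W : Submodule ℝ (NMatrix n)}
    (h : Reach p k W) (u : M4) (hu : u ∈ Matrix.specialUnitaryGroup (Fin 4) ℂ) :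
    Reach p (k + 1) (Submodule.map (embedLin (p k)) (suAlgebra (Fin 4)) ⊔
      Submodule.map (Ad (embedGate (p k) u)) W) := by
  obtain ⟨x, hx⟩ := h
  refine ⟨Function.update x k ⟨u, hu⟩, ?_⟩
  rw [Vsub]
  have e : Vsub p (fun j => ((Function.update x k ⟨u, hu⟩ j : SU4) : M4)) k =
      Vsub p (fun j => (x j : M4)) k := by
    apply Vsub_congr
    intro j hj
    rw [Function.update_of_ne (by omega)]
  rw [e]
  simp only [Function.update_self]
  exact sup_le_sup_left (Submodule.map_mono hx) _

theorem Reach.mono {n : ℕ} {p : ℕ → Fin n × Fin n} {k : ℕ} {W W' : Submodule ℝ (NMatrix n)}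
    (h : Reach p k W) (hW : W' ≤ W) : Reach p k W' := by
  obtain ⟨x, hx⟩ := h
  exact ⟨x, hW.trans hx⟩

theorem Ad_one {n : ℕ} : Ad (1 : NMatrix n) = LinearMap.id := by
  ext1 M; simp [Ad_apply]

theorem Reach.skip {n : ℕ} {p : ℕ → Fin n × Fin n} {k : ℕ} {W : Submodule ℝ (NMatrix n)}
    (h : Reach p k W) (l : ℕ) (hl : k ≤ l) : Reach p l W := by
  induction l, hl using Nat.le_induction with
  | base => exact h
  | succ l _ ih =>
    refine (ih.step 1 (one_mem _)).mono ?_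
    rw [embed_one, Ad_one, Submodule.map_id]
    exact le_sup_right

theorem embed_unitary {n : ℕ} {p : Fin n × Fin n} (hp : p.1 ≠ p.2) {u : M4}
    (hu : u ∈ Matrix.specialUnitaryGroup (Fin 4) ℂ) :
    star (embedGate p u) * embedGate p u = 1 := by
  rw [← embed_star, ← embed_mul hp, (Matrix.mem_unitaryGroup_iff').mp
    (Matrix.mem_specialUnitaryGroup_iff.mp hu).1, embed_one]

/-- One sweep step. -/
theorem sweep_gate {n : ℕ} {p : ℕ → Fin n × Fin n} (hp : ∀ k, (p k).1 ≠ (p k).2) {k t : ℕ}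
    {W : Submodule ℝ (NMatrix n)} (h : Reach p k W) (hW : Module.finrank ℝ W = t)
    {s : Fin n → Fin 4} (hs : s ≠ 0) (hsW : (Complex.I • PS s : NMatrix n) ∉ W) :
    ∃ (W' : Submodule ℝ (NMatrix n)) (s' : Fin n → Fin 4),
      Reach p (k + 1) (Submodule.map (embedLin (p k)) (suAlgebra (Fin 4)) ⊔ W') ∧
      Module.finrank ℝ W' = t ∧ s' ≠ 0 ∧ (Complex.I • PS s' : NMatrix n) ∉ W' ∧
      s' (p k).1 = 0 ∧ (∀ q, q ≠ (p k).1 → q ≠ (p k).2 → s' q = s q) := by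
  by_cases h0 : s (p k).1 = 0 ∧ s (p k).2 = 0
  · refine ⟨W, s, ?_, hW, hs, hsW, h0.1, fun _ _ _ => rfl⟩
    have := h.step 1 (one_mem _)
    rwa [embed_one, Ad_one, Submodule.map_id] at this
  · obtain ⟨b', hb', u, hu, huc⟩ := pauli_move h0
    refine ⟨_, upd (p k) s 0 b', h.step u hu, ?_, ?_, ?_, ?_, ?_⟩
    · rw [← hW]
      exact (Submodule.equivMapOfInjective _ (Ad_inj (embed_unitary (hp k) hu)) W).finrank_eq.symm
    · intro h
      have := congrFun h (p k).2
      simp at this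
      exact hb' this
    · have e : (Complex.I • PS (upd (p k) s 0 b') : NMatrix n) =
          Ad (embedGate (p k) u) (Complex.I • PS s) := by
        rw [Ad_apply, mul_smul_comm, smul_mul_assoc, PS, PS, ← embed_star,
          conj_locM (hp k) (fun i => pauli (s i)) u (star u) (pauli 0) (pauli b') huc]
        congr 2
        funext q
        by_cases h2 : q = (p k).2
        · subst h2; simp
        by_cases h1 : q = (p k).1
        · subst h1; simp [hp k]
        rw [upd_of_ne _ _ _ h1 h2, upd_of_ne _ _ _ h1 h2]
      rw [e]
      rintro ⟨M, hM, hMe⟩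
      rw [Ad_inj (embed_unitary (hp k) hu) hMe] at hM
      exact hsW hM
    · simp [hp k]
    · intro q h1 h2
      rw [upd_of_ne _ _ _ h1 h2]

/-- A single-site Pauli lies in the image of a gate's Lie algebra. -/
theorem PS_mem {n : ℕ} {p : Fin n × Fin n} (hp : p.1 ≠ p.2) {s : Fin n → Fin 4} (hs : s ≠ 0)
    (h : ∀ q, q ≠ p.2 → s q = 0) :
    (Complex.I • PS s : NMatrix n) ∈ Submodule.map (embedLin p) (suAlgebra (Fin 4)) := by
  have hs2 : s p.2 ≠ 0 := by
    intro h2; apply hs; funext q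
    by_cases e : q = p.2
    · rw [e]; exact h2
    · exact h q e
  refine ⟨Complex.I • kron2 1 (pauli (s p.2)), ?_, ?_⟩
  · apply Submodule.subset_span
    constructor
    · rw [← Matrix.star_eq_conjTranspose, star_smul, kron2_star, pauli_star, star_one]
      simp
    · rw [Matrix.trace_smul, kron2_trace, pauli_trace' hs2]; simp
  · show embedGate p _ = _
    have e1 : PS s = locM (upd p (fun _ => (1 : M2)) 1 (pauli (s p.2))) := by
      rw [PS]; congr 1; funext q
      by_cases e : q = p.2
      · subst e; simp
      · rw [h q e]
        by_cases e1 : q = p.1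
        · subst e1; simp [hp, pauli_zero]
        · rw [upd_of_ne _ _ _ e1 e, pauli_zero]
    have e2 : locM (upd p (fun _ => (1 : M2)) 1 1) = (1 : NMatrix n) := by
      have := upd_self (p := p) (fun _ : Fin n => (1 : M2))
      rw [this, locM_one]
    rw [e1, locM_split hp, e2, mul_one]
    ext a b
    simp only [embedGate, Matrix.smul_apply]
    split <;> simp

end BW


namespace BW

theorem bp_lt (n i : ℕ) (hn : 2 ≤ n) : i < (i + 1) * (n * (n - 1)) := by
  have : 1 ≤ n * (n - 1) := Nat.mul_pos (by omega) (by omega)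
  nlinarith

/-- the brickwork pairs, as an infinite sequence -/
def bp (n : ℕ) (hn : 2 ≤ n) (he : n % 2 = 0) (i : ℕ) : Fin n × Fin n :=
  (brickwork n (i + 1) hn he ⟨i, bp_lt n i hn⟩).1

theorem bp_ne (n : ℕ) (hn : 2 ≤ n) (he : n % 2 = 0) (i : ℕ) :
    (bp n hn he i).1 ≠ (bp n hn he i).2 := (brickwork n (i + 1) hn he ⟨i, bp_lt n i hn⟩).2

theorem brickwork_eq (n T : ℕ) (hn : 2 ≤ n) (he : n % 2 = 0) (i : Fin (T * (n * (n - 1)))) :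
    (brickwork n T hn he i).1 = bp n hn he i := by
  unfold bp brickwork
  rfl

theorem bp_exists (n : ℕ) (hn : 2 ≤ n) (he : n % 2 = 0) (k r j : ℕ) (hk : k = r * (n - 1))
    (hj : j + 2 ≤ n) :
    ∃ i, k ≤ i ∧ i < k + (n - 1) ∧ ((bp n hn he i).1 : ℕ) = j ∧ ((bp n hn he i).2 : ℕ) = j + 1 := by
  have hmod : ∀ m, m < n - 1 → (k + m) % (n - 1) = m := by
    intro m hm
    rw [hk, Nat.mul_comm, Nat.mul_add_mod, Nat.mod_eq_of_lt hm]
  rcases Nat.even_or_odd' j with ⟨m, rfl | rfl⟩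
  · refine ⟨k + m, by omega, by omega, ?_⟩
    have h1 : (k + m) % (n - 1) = m := hmod m (by omega)
    unfold bp brickwork
    have h2 : (k + m) % (n - 1) < n / 2 := by omega
    simp only [dif_pos h2]
    omega
  · refine ⟨k + (n / 2 + m), by omega, by omega, ?_⟩
    have h1 : (k + (n / 2 + m)) % (n - 1) = n / 2 + m := hmod _ (by omega)
    unfold bp brickwork
    have h2 : ¬ (k + (n / 2 + m)) % (n - 1) < n / 2 := by omega
    simp only [dif_neg h2]
    omega

theorem sweep (n : ℕ) (hn : 2 ≤ n) (he : n % 2 = 0) (t : ℕ) (W : Submodule ℝ (NMatrix n))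
    (h : Reach (bp n hn he) (t * (n * (n - 1))) W) (hW : Module.finrank ℝ W = t)
    (ht : t < 4 ^ n - 1) (j : ℕ) (hj : j + 2 ≤ n) :
    ∃ (W' : Submodule ℝ (NMatrix n)) (s : Fin n → Fin 4),
      Reach (bp n hn he) (t * (n * (n - 1)) + j * (n - 1)) W' ∧ Module.finrank ℝ W' = t ∧
      s ≠ 0 ∧ (Complex.I • PS s : NMatrix n) ∉ W' ∧ ∀ q : Fin n, (q : ℕ) < j → s q = 0 := by
  induction j with
  | zero =>
    obtain ⟨s, hs, hsW⟩ := exists_PS_notMem W (by omega)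
    exact ⟨W, s, by simpa using h, hW, hs, hsW, fun q hq => by omega⟩
  | succ j ih =>
    obtain ⟨W', s, hr, hf, hs, hsW, hz⟩ := ih (by omega)
    obtain ⟨i, hi1, hi2, hb1, hb2⟩ := bp_exists n hn he (t * (n * (n - 1)) + j * (n - 1))
      (t * n + j) j (by ring) (by omega)
    obtain ⟨W2, s2, hr2, hf2, hs2, hsW2, hz1, hz2⟩ :=
      sweep_gate (bp_ne n hn he) (hr.skip i hi1) hf hs hsW
    refine ⟨W2, s2, (hr2.mono le_sup_right).skip _ ?_, hf2, hs2, hsW2, ?_⟩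
    · rw [Nat.add_mul, one_mul]; omega
    · intro q hq
      by_cases e : (q : ℕ) = j
      · have : q = (bp n hn he i).1 := Fin.ext (by omega)
        rw [this, hz1]
      · rw [hz2 q (fun h => e (by rw [h, hb1])) (fun h => by rw [h, hb2] at hq; omega)]
        exact hz q (by omega)

theorem block (n : ℕ) (hn : 2 ≤ n) (he : n % 2 = 0) (t : ℕ) (W : Submodule ℝ (NMatrix n))
    (h : Reach (bp n hn he) (t * (n * (n - 1))) W) (hW : Module.finrank ℝ W = t)
    (ht : t < 4 ^ n - 1) :
    ∃ (W' : Submodule ℝ (NMatrix n)),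
      Reach (bp n hn he) ((t + 1) * (n * (n - 1))) W' ∧ t + 1 ≤ Module.finrank ℝ W' := by
  obtain ⟨W', s, hr, hf, hs, hsW, hz⟩ := sweep n hn he t W h hW ht (n - 2) (by omega)
  obtain ⟨i, hi1, hi2, hb1, hb2⟩ := bp_exists n hn he (t * (n * (n - 1)) + (n - 2) * (n - 1))
      (t * n + (n - 2)) (n - 2) (by ring) (by omega)
  obtain ⟨W2, s2, hr2, hf2, hs2, hsW2, hz1, hz2⟩ :=
      sweep_gate (bp_ne n hn he) (hr.skip i hi1) hf hs hsW
  refine ⟨_, hr2.skip _ ?_, ?_⟩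
  · obtain ⟨c, rfl⟩ : ∃ c, n = c + 2 := ⟨n - 2, by omega⟩
    simp only [Nat.add_sub_cancel, show c + 2 - 1 = c + 1 by omega] at *
    nlinarith
  · have hm : (Complex.I • PS s2 : NMatrix n) ∈
        Submodule.map (embedLin (bp n hn he i)) (suAlgebra (Fin 4)) := by
      apply PS_mem (bp_ne n hn he i) hs2
      intro q hq
      by_cases e : q = (bp n hn he i).1
      · rw [e, hz1]
      · rw [hz2 q e hq]
        apply hz
        have h1 : (q : ℕ) ≠ n - 2 := fun h => e (Fin.ext (by omega))
        have h2 : (q : ℕ) ≠ n - 1 := fun h => hq (Fin.ext (by omega))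
        omega
    have hlt : W2 < Submodule.map (embedLin (bp n hn he i)) (suAlgebra (Fin 4)) ⊔ W2 := by
      refine lt_of_le_of_ne le_sup_right ?_
      intro heq
      apply hsW2
      rw [heq]
      exact Submodule.mem_sup_left hm
    have := Submodule.finrank_lt_finrank_of_lt hlt
    omega

theorem rank_lower (n : ℕ) (hn : 2 ≤ n) (he : n % 2 = 0) (t : ℕ) (ht : t ≤ 4 ^ n - 1) :
    ∃ (W : Submodule ℝ (NMatrix n)),
      Reach (bp n hn he) (t * (n * (n - 1))) W ∧ t ≤ Module.finrank ℝ W := by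
  induction t with
  | zero => exact ⟨⊥, ⟨fun _ => 1, bot_le⟩, by simp⟩
  | succ t ih =>
    obtain ⟨W, hr, hf⟩ := ih (by omega)
    by_cases h : t + 1 ≤ Module.finrank ℝ W
    · exact ⟨W, hr.skip _ (Nat.mul_le_mul_right _ (by omega)), h⟩
    · exact block n hn he t W hr (by omega) (by omega)

end BW

namespace BW

section Null
variable {E : Type*} [NormedAddCommGroup E] [NormedSpace ℝ E] [FiniteDimensional ℝ E]
  [MeasurableSpace E] [BorelSpace E] (μ : Measure E) [μ.IsAddHaarMeasure]

theorem null_one (f : ℝ → ℝ) (hf : AnalyticOnNhd ℝ f Set.univ) {x : ℝ} (hx : f x ≠ 0) :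
    volume {t | f t = 0} = 0 := by
  have h := hf.preimage_zero_mem_codiscrete hx
  have h2 := ae_restrict_le_codiscreteWithin (μ := (volume : Measure ℝ)) MeasurableSet.univ h
  rw [Measure.restrict_univ, mem_ae_iff] at h2
  convert h2 using 2
  ext t; simp

theorem null_analytic (f : E → ℝ) (hf : AnalyticOnNhd ℝ f Set.univ) {p : E} (hp : f p ≠ 0) :
    μ {x | f x = 0} = 0 := by
  have hc : Continuous f := continuous_iff_continuousAt.2 fun x => (hf x trivial).continuousAt
  let S : Set (E × ℝ) := {q | f (p + q.2 • q.1) = 0}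
  have hS : MeasurableSet S := by
    apply IsClosed.measurableSet
    exact isClosed_eq (by fun_prop) continuous_const
  have h1 : (μ.prod (volume : Measure ℝ)) S = 0 := by
    rw [Measure.measure_prod_null hS]
    refine Filter.Eventually.of_forall fun v => ?_
    refine null_one (fun t => f (p + t • v)) ?_ (x := 0) (by simpa using hp)
    intro t _
    refine (hf _ trivial).comp_of_eq (f := fun t : ℝ => p + t • v) (x := t) ?_ rfl
    exact analyticAt_const.add (analyticAt_id.smul analyticAt_const)
  have h2 : ((volume : Measure ℝ).prod μ) (Prod.swap ⁻¹' S) = 0 := by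
    rw [← Measure.prod_swap, Measure.map_apply measurable_swap (measurable_swap hS)]
    simpa [Set.preimage_preimage] using h1
  rw [Measure.measure_prod_null (measurable_swap hS)] at h2
  have h3 : ∀ᵐ t : ℝ, t ≠ 0 := by
    rw [ae_iff]; simp
  obtain ⟨t, ht, ht0⟩ := (h2.and h3).exists
  have h4 : μ ((fun v => t • v) ⁻¹' ((fun v => p + v) ⁻¹' {x | f x = 0})) = 0 := ht
  rw [Measure.addHaar_preimage_smul μ ht0, measure_preimage_add] at h4
  simpa [ht0] using h4

theorem null_equidim (Ψ : E → E) (hΨ : AnalyticOnNhd ℝ Ψ Set.univ) {p : E}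
    (hp : (fderiv ℝ Ψ p).det ≠ 0) {N : Set E} (hN : μ N = 0) : μ (Ψ ⁻¹' N) = 0 := by
  have hdet : AnalyticOnNhd ℝ (fun x => (fderiv ℝ Ψ x).det) Set.univ := by
    have hd := hΨ.fderiv
    let b := Module.finBasis ℝ E
    have : (fun x => (fderiv ℝ Ψ x).det) = fun x => Matrix.det
        (Matrix.of fun i j => b.coord i (fderiv ℝ Ψ x (b j))) := by
      ext x
      rw [ContinuousLinearMap.det, ← LinearMap.det_toMatrix b]
      congr 1
      ext i j
      simp [LinearMap.toMatrix_apply]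
    rw [this]
    simp_rw [Matrix.det_apply]
    intro x _
    refine Finset.analyticAt_fun_sum _ fun σ _ => ?_
    refine AnalyticAt.const_smul ?_
    refine Finset.analyticAt_fun_prod _ fun i _ => ?_
    let ℓ : (E →L[ℝ] E) →L[ℝ] ℝ :=
      (LinearMap.toContinuousLinearMap (b.coord (σ i))).comp (ContinuousLinearMap.apply ℝ E (b i))
    exact (ℓ.analyticAt _).comp (hd x trivial)
  have hz := null_analytic μ _ hdet hp
  obtain ⟨N', hNN', hN'm, hN'⟩ := exists_measurable_superset_of_null hN
  have hcont : Continuous Ψ :=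
    continuous_iff_continuousAt.2 fun x => (hΨ x trivial).continuousAt
  suffices h : μ (Ψ ⁻¹' N' ∩ {x | (fderiv ℝ Ψ x).det ≠ 0}) = 0 by
    refine measure_mono_null ?_ (measure_union_null h hz)
    intro x hx
    by_cases hx0 : (fderiv ℝ Ψ x).det = 0
    · exact Or.inr hx0
    · exact Or.inl ⟨hNN' hx, hx0⟩
  refine measure_null_of_locally_null _ fun x hx => ?_
  have hs : HasStrictFDerivAt Ψ (fderiv ℝ Ψ x) x := (hΨ x trivial).hasStrictFDerivAt
  have hx2 : (fderiv ℝ Ψ x).det ≠ 0 := hx.2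
  let e := (fderiv ℝ Ψ x).toContinuousLinearEquivOfDetNeZero hx2
  have hs' : HasStrictFDerivAt Ψ (e : E →L[ℝ] E) x := hs
  let φ := hs'.toOpenPartialHomeomorph Ψ
  have hdc : Continuous fun x => (fderiv ℝ Ψ x).det :=
    continuous_iff_continuousAt.2 fun x => (hdet x trivial).continuousAt
  have hm0 : MeasurableSet {x | (fderiv ℝ Ψ x).det ≠ 0} :=
    (isOpen_ne_fun hdc continuous_const).measurableSet
  let s : Set E := Ψ ⁻¹' N' ∩ {x | (fderiv ℝ Ψ x).det ≠ 0} ∩ φ.source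
  have hsm : MeasurableSet s :=
    ((hcont.measurable hN'm).inter hm0).inter φ.open_source.measurableSet
  refine ⟨s, ?_, ?_⟩
  · exact inter_mem_nhdsWithin _
      (φ.open_source.mem_nhds hs'.mem_toOpenPartialHomeomorph_source)
  · have hinj : Set.InjOn Ψ s := φ.injOn.mono fun y hy => hy.2
    have := lintegral_abs_det_fderiv_eq_addHaar_image μ hsm (f := Ψ) (f' := fun x => fderiv ℝ Ψ x)
      (fun y _ => (hΨ y trivial).differentiableAt.hasFDerivAt.hasFDerivWithinAt) hinj
    rw [measure_mono_null (t := N') (by rintro _ ⟨y, hy, rfl⟩; exact hy.1.1) hN',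
      lintegral_eq_zero_iff (by exact (ENNReal.measurable_ofReal.comp (hdc.abs.measurable)))] at this
    rw [Filter.EventuallyEq, ae_restrict_iff' hsm] at this
    rw [← compl_mem_ae_iff]
    filter_upwards [this] with y hy hys
    have h1 := hy hys
    have h2 : (fderiv ℝ Ψ y).det ≠ 0 := hys.1.2
    simp at h1
    exact h2 h1

theorem null_submersion {F : Type*} [NormedAddCommGroup F] [NormedSpace ℝ F]
    [FiniteDimensional ℝ F] [MeasurableSpace F] [BorelSpace F] (ν : Measure F)
    [ν.IsAddHaarMeasure] (ψ : E → F) (hψ : AnalyticOnNhd ℝ ψ Set.univ) {p : E}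
    (hp : Function.Surjective (fderiv ℝ ψ p)) {N : Set F} (hN : ν N = 0) :
    μ (ψ ⁻¹' N) = 0 := by
  set L := fderiv ℝ ψ p with hL
  obtain ⟨σ, hσ⟩ := (L : E →ₗ[ℝ] F).exists_rightInverse_of_surjective
    (LinearMap.range_eq_top.2 hp)
  let σ' : F →L[ℝ] E := LinearMap.toContinuousLinearMap σ
  have hσ' : ∀ y, L (σ' y) = y := fun y => LinearMap.congr_fun hσ y
  let Ψ : E → E := fun x => x + σ' (ψ x - L x)
  have hΨ : AnalyticOnNhd ℝ Ψ Set.univ := by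
    intro x _
    refine analyticAt_id.add ((σ'.analyticAt _).comp ((hψ x trivial).sub (L.analyticAt x)))
  have hLΨ : ∀ x, L (Ψ x) = ψ x := by
    intro x; simp [Ψ, hσ']
  have hd : fderiv ℝ Ψ p = ContinuousLinearMap.id ℝ E := by
    apply HasFDerivAt.fderiv
    have h1 : HasFDerivAt ψ L p := (hψ p trivial).differentiableAt.hasFDerivAt
    have := (hasFDerivAt_id p).add ((σ'.hasFDerivAt).comp p (h1.sub L.hasFDerivAt))
    refine this.congr_fderiv ?_
    ext; simp
  obtain ⟨N', hNN', hN'm, hN'⟩ := exists_measurable_superset_of_null hN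
  have hLN : μ (L ⁻¹' N') = 0 := by
    have := ae_comp_linearMap_mem_iff (L : E →ₗ[ℝ] F) μ ν hp hN'm.compl
    have h2 : ∀ᵐ y ∂ν, y ∈ N'ᶜ := by rw [ae_iff]; simpa using hN'
    have h3 := this.2 h2
    rw [ae_iff] at h3
    simp only [Set.mem_compl_iff, not_not] at h3
    exact h3
  have := null_equidim μ Ψ hΨ (p := p) (by rw [hd]; simp [ContinuousLinearMap.det]) hLN
  refine measure_mono_null ?_ this
  intro x hx
  show L (Ψ x) ∈ N'
  rw [hLΨ]; exact hNN' hx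

theorem null_avg {G : Type*} [Group G] [TopologicalSpace G] [IsTopologicalGroup G]
    [MeasurableSpace G] [BorelSpace G] [SecondCountableTopology G]
    (ν : Measure G) [ν.IsMulLeftInvariant] [SFinite ν] [NeZero μ]
    {Z : Set G} (hZ : IsClosed Z) (φ : E → G) (hφ : Continuous φ)
    (h : ∀ g, μ {e | φ e * g ∈ Z} = 0) : ν Z = 0 := by
  let S : Set (G × E) := {q | φ q.2 * q.1 ∈ Z}
  have hS : MeasurableSet S := (hZ.preimage (by fun_prop)).measurableSet
  have h1 : (ν.prod μ) S = 0 := by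
    rw [Measure.measure_prod_null hS]
    exact Filter.Eventually.of_forall h
  have h2 : (μ.prod ν) (Prod.swap ⁻¹' S) = 0 := by
    rw [← Measure.prod_swap, Measure.map_apply measurable_swap (measurable_swap hS)]
    simpa [Set.preimage_preimage] using h1
  rw [Measure.measure_prod_null (measurable_swap hS)] at h2
  obtain ⟨e, he⟩ := h2.exists
  have : ν ((fun g => φ e * g) ⁻¹' Z) = 0 := he
  rwa [measure_preimage_mul] at this

end Null
end BW

namespace BW

section Exp
variable {m : Type*} [Fintype m] [DecidableEq m]

theorem mem_su {H : Matrix m m ℂ} : H ∈ suAlgebra m ↔ Hᴴ = -H ∧ H.trace = 0 := by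
  constructor
  · intro h
    refine Submodule.span_induction (p := fun H _ => Hᴴ = -H ∧ H.trace = 0)
      (fun x hx => hx) ⟨by simp, by simp⟩ ?_ ?_ h
    · rintro x y _ _ ⟨h1, h2⟩ ⟨h3, h4⟩
      exact ⟨by rw [Matrix.conjTranspose_add, h1, h3]; abel, by simp [h2, h4]⟩
    · rintro a x _ ⟨h1, h2⟩
      exact ⟨by rw [Matrix.conjTranspose_smul, h1]; simp, by simp [Matrix.trace_smul, h2]⟩
  · intro h; exact Submodule.subset_span h

theorem herm_diag {A : Matrix m m ℂ} (hA : A.IsHermitian) : ∃ (V : Matrix m m ℂ) (d : m → ℝ),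
    star V * V = 1 ∧ V * star V = 1 ∧ A = V * Matrix.diagonal (fun i => (d i : ℂ)) * star V := by
  refine ⟨hA.eigenvectorUnitary, hA.eigenvalues, ?_, ?_, ?_⟩
  · simp
  · simp
  · conv_lhs => rw [hA.spectral_theorem]
    rw [Unitary.conjStarAlgAut_apply]
    rfl

theorem exp_conj_diag {V : Matrix m m ℂ} (h1 : star V * V = 1) (h2 : V * star V = 1) (d : m → ℂ) :
    NormedSpace.exp (V * Matrix.diagonal d * star V) =
      V * Matrix.diagonal (fun i => Complex.exp (d i)) * star V := by
  have := Matrix.exp_units_conj (⟨V, star V, h2, h1⟩ : (Matrix m m ℂ)ˣ) (Matrix.diagonal d)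
  simp only [Matrix.exp_diagonal] at this
  rw [Units.inv_mk] at this
  refine this.trans ?_
  congr 3
  rw [Pi.exp_def, Complex.exp_eq_exp_ℂ]

theorem det_conj {V D : Matrix m m ℂ} (h2 : V * star V = 1) :
    (V * D * star V).det = D.det := by
  rw [Matrix.det_mul, Matrix.det_mul, mul_right_comm, ← Matrix.det_mul, h2]; simp

theorem trace_conj {V D : Matrix m m ℂ} (h1 : star V * V = 1) :
    (V * D * star V).trace = D.trace := by
  rw [Matrix.trace_mul_comm, ← mul_assoc, h1, one_mul]

theorem su_diag {H : Matrix m m ℂ} (hH : Hᴴ = -H) : ∃ (V : Matrix m m ℂ) (d : m → ℝ),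
    star V * V = 1 ∧ V * star V = 1 ∧
      H = V * Matrix.diagonal (fun i => (d i : ℂ) * Complex.I) * star V := by
  have hA : (Complex.I • H).IsHermitian := by
    rw [Matrix.IsHermitian, Matrix.conjTranspose_smul, hH]; simp
  obtain ⟨V, d, h1, h2, h3⟩ := herm_diag hA
  refine ⟨V, fun i => - d i, h1, h2, ?_⟩
  have : H = (-Complex.I) • (Complex.I • H) := by rw [smul_smul]; simp
  rw [this, h3, ← Matrix.smul_mul, ← Matrix.mul_smul, ← Matrix.diagonal_smul]
  congr 3
  ext i; simp; ring

theorem exp_mem_SU {H : Matrix m m ℂ} (hH : H ∈ suAlgebra m) :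
    NormedSpace.exp H ∈ Matrix.specialUnitaryGroup m ℂ := by
  obtain ⟨h1, h2⟩ := mem_su.1 hH
  obtain ⟨V, d, hV1, hV2, rfl⟩ := su_diag h1
  rw [exp_conj_diag hV1 hV2]
  rw [Matrix.mem_specialUnitaryGroup_iff, det_conj hV2, Matrix.det_diagonal]
  rw [trace_conj hV1, Matrix.trace_diagonal] at h2
  refine ⟨?_, by rw [← Complex.exp_sum, h2, Complex.exp_zero]⟩
  have hV : V ∈ Matrix.unitaryGroup m ℂ := ⟨hV1, hV2⟩
  refine mul_mem (mul_mem hV ?_) (Unitary.star_mem hV)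
  rw [Matrix.mem_unitaryGroup_iff, Matrix.star_eq_conjTranspose, Matrix.diagonal_conjTranspose,
    Matrix.diagonal_mul_diagonal, ← Matrix.diagonal_one]
  congr 1
  ext i
  simp only [Pi.star_apply, Complex.star_def, ← Complex.exp_conj, ← Complex.exp_add]
  simp

theorem exists_phase (U : Matrix m m ℂ) : ∃ c : ℂ, star c * c = 1 ∧ (1 + c • U).det ≠ 0 := by
  have hinf : (Metric.sphere (0:ℂ) 1).Infinite := by
    have : (Metric.sphere (0:ℂ) 1).Nontrivial := ⟨1, by simp, -1, by simp, by norm_num⟩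
    refine IsPreconnected.infinite_of_nontrivial ?_ this
    exact isPreconnected_sphere (by simp [Complex.rank_real_complex]) 0 1
  have hp : U.charpoly ≠ 0 := (Matrix.charpoly_monic U).ne_zero
  obtain ⟨z, hz, hz2⟩ := hinf.exists_notMem_finset U.charpoly.roots.toFinset
  have hz1 : ‖z‖ = 1 := by simpa using hz
  have hz0 : z ≠ 0 := by rintro rfl; simp at hz1
  have hev : U.charpoly.eval z ≠ 0 := by
    intro h; apply hz2; simp [hp, h]
  rw [Matrix.eval_charpoly] at hev
  refine ⟨-z⁻¹, ?_, ?_⟩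
  · simp only [Complex.star_def]
    rw [mul_comm, Complex.mul_conj, Complex.normSq_eq_norm_sq]; simp [hz1]
  · intro h
    apply hev
    have : Matrix.scalar m z - U = z • (1 + (-z⁻¹) • U) := by
      rw [smul_add, smul_smul, Matrix.smul_one_eq_diagonal]
      simp [hz0, sub_eq_add_neg]
    rw [this, Matrix.det_smul, h, mul_zero]

theorem unit_norm_exp {z : ℂ} (hz : ‖z‖ = 1) : ∃ t : ℝ, z = Complex.exp (t * Complex.I) :=
  ⟨z.arg, by have := Complex.norm_mul_exp_arg_mul_I z; rw [hz] at this; simpa using this.symm⟩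

theorem unitary_diag {U : Matrix m m ℂ} (hU : star U * U = 1) :
    ∃ (V : Matrix m m ℂ) (d : m → ℝ), star V * V = 1 ∧ V * star V = 1 ∧
      U = V * Matrix.diagonal (fun i => Complex.exp ((d i : ℂ) * Complex.I)) * star V := by
  obtain ⟨c, hc, hdet⟩ := exists_phase U
  set W := c • U with hW
  have hWW : star W * W = 1 := by
    rw [hW, star_smul, Matrix.smul_mul, Matrix.mul_smul, hU, smul_smul, hc, one_smul]
  have hWW2 : W * star W = 1 := mul_eq_one_comm.1 hWW
  set B := 1 + W with hB
  have hBu : IsUnit B.det := isUnit_iff_ne_zero.2 hdet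
  have hBi : B * B⁻¹ = 1 := Matrix.mul_nonsing_inv _ hBu
  have hBi2 : B⁻¹ * B = 1 := Matrix.nonsing_inv_mul _ hBu
  have hAB : ∃ A : Matrix m m ℂ, A * B = Complex.I • (1 - W) :=
    ⟨Complex.I • (1 - W) * B⁻¹, by rw [mul_assoc, hBi2, mul_one]⟩
  obtain ⟨A, hA⟩ := hAB
  -- Hermitian
  have hBs : IsUnit (star B) := by
    exact ((Matrix.isUnit_iff_isUnit_det B).2 hBu).star
  have hBU : IsUnit B := (Matrix.isUnit_iff_isUnit_det B).2 hBu
  have hherm : A.IsHermitian := by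
    have e1 : star B * A * B = star B * star A * B := by
      have e2 : star B * star A = star (A * B) := by simp
      rw [e2, mul_assoc, hA, hB]
      simp only [star_smul, star_sub, star_add, star_one, Matrix.mul_smul, Matrix.smul_mul]
      rw [add_mul, sub_mul, mul_sub, mul_sub, mul_add, mul_add, hWW]
      simp only [Complex.star_def, Complex.conj_I, one_mul, mul_one]
      rw [neg_smul, ← smul_neg]
      congr 1; abel
    exact (hBs.mul_left_cancel (hBU.mul_right_cancel e1)).symm
  obtain ⟨V, d, h1, h2, h3⟩ := herm_diag hherm
  -- (A + i) W = i - A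
  have hdi : ∀ i, (d i : ℂ) + Complex.I ≠ 0 := by
    intro i h
    have := congrArg Complex.im h
    simp at this
  have key : (A + Complex.I • 1) * W = Complex.I • 1 - A := by
    have : A + A * W = Complex.I • 1 - Complex.I • W := by
      rw [← smul_sub, ← hA, hB, mul_add, mul_one]
    rw [add_mul, Matrix.smul_mul, one_mul]
    have h5 : A * W = Complex.I • 1 - Complex.I • W - A := by rw [← this]; abel
    rw [h5]; abel
  have hWV : star V * W * V = Matrix.diagonal
      (fun i => (Complex.I - d i) / (d i + Complex.I)) := by
    have hs1 : (1 : Matrix m m ℂ) = V * 1 * star V := by rw [mul_one, h2]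
    have e1 : A + Complex.I • 1 = V * Matrix.diagonal (fun i => (d i : ℂ) + Complex.I) * star V := by
      have : Matrix.diagonal (fun i => (d i : ℂ) + Complex.I) =
        Matrix.diagonal (fun i => (d i : ℂ)) + Complex.I • (1 : Matrix m m ℂ) := by
        rw [← Matrix.diagonal_add, Matrix.smul_one_eq_diagonal]
      rw [this, mul_add, add_mul, ← h3, Matrix.mul_smul, Matrix.smul_mul, mul_one, h2]
    have e2 : Complex.I • 1 - A = V * Matrix.diagonal (fun i => Complex.I - (d i : ℂ)) * star V := by
      have : Matrix.diagonal (fun i => Complex.I - (d i : ℂ)) =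
        Complex.I • (1 : Matrix m m ℂ) - Matrix.diagonal (fun i => (d i : ℂ)) := by
        rw [← Matrix.diagonal_sub, Matrix.smul_one_eq_diagonal]
      rw [this, mul_sub, sub_mul, ← h3, Matrix.mul_smul, Matrix.smul_mul, mul_one, h2]
    rw [e1, e2] at key
    have key2 : Matrix.diagonal (fun i => (d i : ℂ) + Complex.I) * (star V * W * V) =
        Matrix.diagonal (fun i => Complex.I - (d i : ℂ)) := by
      have := congrArg (fun M => star V * M * V) key
      simp only [mul_assoc] at this
      simp only [h1, mul_one] at this
      rw [← mul_assoc (star V) V, ← mul_assoc (star V) V, h1, one_mul, one_mul] at this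
      simpa only [mul_assoc] using this
    have key3 := congrArg (fun M => Matrix.diagonal (fun i => ((d i : ℂ) + Complex.I)⁻¹) * M) key2
    simp only [← mul_assoc, Matrix.diagonal_mul_diagonal] at key3
    rw [show (fun i => ((d i : ℂ) + Complex.I)⁻¹ * ((d i : ℂ) + Complex.I)) = fun _ => 1 from
      funext fun i => inv_mul_cancel₀ (hdi i), Matrix.diagonal_one, one_mul] at key3
    rw [key3]
    congr 1
    ext i; rw [div_eq_inv_mul]
  have hUV : U = V * (star c • Matrix.diagonal
      (fun i => (Complex.I - d i) / (d i + Complex.I))) * star V := by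
    rw [← hWV, hW]
    simp only [Matrix.mul_smul, Matrix.smul_mul, smul_smul, hc, one_smul]
    simp only [mul_assoc, h2, mul_one]
    rw [← mul_assoc, h2, one_mul]
  have hc1 : ‖c‖ = 1 := by
    have h6 := hc
    rw [Complex.star_def, mul_comm, Complex.mul_conj, Complex.normSq_eq_norm_sq] at h6
    have : ‖c‖ ^ 2 = 1 := by exact_mod_cast h6
    nlinarith [norm_nonneg c]
  have hn : ∀ i, ∃ t : ℝ, star c * ((Complex.I - d i) / (d i + Complex.I)) =
      Complex.exp (t * Complex.I) := by
    intro i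
    apply unit_norm_exp
    rw [norm_mul, norm_star, hc1, one_mul, norm_div]
    have : ‖Complex.I - (d i : ℂ)‖ = ‖(d i : ℂ) + Complex.I‖ := by
      rw [Complex.norm_def, Complex.norm_def]
      congr 1
      simp [Complex.normSq_apply]
    rw [this, div_self (norm_ne_zero_iff.2 (hdi i))]
  choose t ht using hn
  refine ⟨V, t, h1, h2, ?_⟩
  rw [hUV, ← Matrix.diagonal_smul]
  congr 3
  ext i
  simp only [Pi.smul_apply, smul_eq_mul, ht]

theorem exp_surj [Nonempty m] {U : Matrix m m ℂ} (hU : U ∈ Matrix.specialUnitaryGroup m ℂ) :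
    ∃ H ∈ suAlgebra m, NormedSpace.exp H = U := by
  rw [Matrix.mem_specialUnitaryGroup_iff] at hU
  obtain ⟨V, d, h1, h2, rfl⟩ := unitary_diag hU.1.1
  have hdet := hU.2
  rw [det_conj h2, Matrix.det_diagonal, ← Complex.exp_sum, Complex.exp_eq_one_iff] at hdet
  obtain ⟨k, hk⟩ := hdet
  obtain ⟨i₀⟩ := (inferInstance : Nonempty m)
  let d' : m → ℂ := fun i => d i * Complex.I - if i = i₀ then k * (2 * Real.pi * Complex.I) else 0
  refine ⟨V * Matrix.diagonal d' * star V, mem_su.2 ⟨?_, ?_⟩, ?_⟩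
  · rw [← Matrix.star_eq_conjTranspose]
    simp only [star_mul, star_star, mul_assoc]
    rw [← mul_neg, ← neg_mul]
    congr 2
    rw [Matrix.star_eq_conjTranspose, Matrix.diagonal_conjTranspose, Matrix.diagonal_neg]
    congr 1
    ext i
    simp only [Pi.star_apply, d']
    split_ifs <;> simp <;> ring
  · rw [trace_conj h1, Matrix.trace_diagonal]
    simp [d', Finset.sum_sub_distrib, hk]
  · rw [exp_conj_diag h1 h2]
    congr 3
    ext i
    simp only [d', Complex.exp_sub]
    split_ifs
    · rw [Complex.exp_int_mul_two_pi_mul_I, div_one]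
    · simp

end Exp
end BW

namespace BW

theorem kron2_eq (k l : M2) :
    kron2 k l = Matrix.reindex finProdFinEquiv finProdFinEquiv (k ⊗ₖ l) := by
  ext a b
  rfl

theorem kron2_det (k l : M2) : (kron2 k l).det = k.det ^ 2 * l.det ^ 2 := by
  rw [kron2_eq]
  erw [Matrix.det_reindex_self]
  rw [Matrix.det_kronecker]; simp

theorem kron2_mem {k l : M2} (hk : k ∈ Matrix.specialUnitaryGroup (Fin 2) ℂ)
    (hl : l ∈ Matrix.specialUnitaryGroup (Fin 2) ℂ) :
    kron2 k l ∈ Matrix.specialUnitaryGroup (Fin 4) ℂ := by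
  rw [Matrix.mem_specialUnitaryGroup_iff] at *
  refine ⟨?_, by rw [kron2_det, hk.2, hl.2]; simp⟩
  rw [Matrix.mem_unitaryGroup_iff, kron2_star, kron2_mul, Matrix.mem_unitaryGroup_iff.1 hk.1,
    Matrix.mem_unitaryGroup_iff.1 hl.1, kron2_one]

/-- left and right tensor embeddings -/
noncomputable def kL : M2 →ₗ[ℝ] M4 where
  toFun k := kron2 k 1
  map_add' u v := by funext a b; simp [kron2, add_mul]
  map_smul' r u := by funext a b; simp [kron2, mul_assoc]

noncomputable def kR : M2 →ₗ[ℝ] M4 where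
  toFun k := kron2 1 k
  map_add' u v := by funext a b; simp [kron2, mul_add]
  map_smul' r u := by funext a b; simp [kron2, mul_left_comm]

theorem kL_su {Y : M2} (hY : Y ∈ suAlgebra (Fin 2)) : kL Y ∈ suAlgebra (Fin 4) := by
  rw [mem_su] at *
  refine ⟨?_, ?_⟩
  · rw [← Matrix.star_eq_conjTranspose, ← map_neg, ← hY.1]
    show star (kron2 _ _) = kron2 _ _
    rw [kron2_star, star_one]; rfl
  · show (kron2 _ _).trace = 0
    rw [kron2_trace, hY.2, zero_mul]

theorem kR_su {Y : M2} (hY : Y ∈ suAlgebra (Fin 2)) : kR Y ∈ suAlgebra (Fin 4) := by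
  rw [mem_su] at *
  refine ⟨?_, ?_⟩
  · rw [← Matrix.star_eq_conjTranspose, ← map_neg, ← hY.1]
    show star (kron2 _ _) = kron2 _ _
    rw [kron2_star, star_one]; rfl
  · show (kron2 _ _).trace = 0
    rw [kron2_trace, hY.2, mul_zero]

/-- the Lie algebra of local unitaries -/
noncomputable def kK : (suAlgebra (Fin 2) × suAlgebra (Fin 2)) →ₗ[ℝ] M4 :=
  (kL ∘ₗ (suAlgebra (Fin 2)).subtype).coprod (kR ∘ₗ (suAlgebra (Fin 2)).subtype)

theorem kK_apply (Y : suAlgebra (Fin 2) × suAlgebra (Fin 2)) :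
    kK Y = kron2 Y.1 1 + kron2 1 Y.2 := rfl

theorem kK_inj : Function.Injective kK := by
  rw [← LinearMap.ker_eq_bot, LinearMap.ker_eq_bot']
  rintro ⟨⟨A, hA⟩, ⟨B, hB⟩⟩ h
  rw [kK_apply] at h
  have he : ∀ i j k l, A i k * (1 : M2) j l + (1 : M2) i k * B j l = 0 := by
    intro i j k l
    have := congrFun (congrFun h (pairIdx i j)) (pairIdx k l)
    rw [Matrix.add_apply, kron2_apply, kron2_apply] at this
    simpa using this
  have tA := (mem_su.1 hA).2
  have tB := (mem_su.1 hB).2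
  rw [Matrix.trace_fin_two] at tA tB
  have hA01 := he 0 0 1 0
  have hA10 := he 1 0 0 0
  have hB01 := he 0 0 0 1
  have hB10 := he 0 1 0 0
  have h00 := he 0 0 0 0
  have h10 := he 1 0 1 0
  have h01 := he 0 1 0 1
  simp at hA01 hA10 hB01 hB10 h00 h10 h01
  have a00 : A 0 0 = 0 := by linear_combination (1/2) * tA + (1/2) * h00 - (1/2) * h10
  have a11 : A 1 1 = 0 := by linear_combination tA - a00
  have b00 : B 0 0 = 0 := by linear_combination h00 - a00
  have b11 : B 1 1 = 0 := by linear_combination tB - b00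
  refine Prod.ext (Subtype.ext ?_) (Subtype.ext ?_)
  · ext i j; fin_cases i <;> fin_cases j <;> simp [a00, a11, hA01, hA10]
  · ext i j; fin_cases i <;> fin_cases j <;> simp [b00, b11, hB01, hB10]

section dims
variable (m : Type*) [Fintype m] [DecidableEq m]

/-- Hermitian matrices -/
noncomputable def hermS : Submodule ℝ (Matrix m m ℂ) where
  carrier := {H | Hᴴ = H}
  add_mem' {a b} ha hb := by
    show (a + b)ᴴ = a + b
    rw [Matrix.conjTranspose_add, show aᴴ = a from ha, show bᴴ = b from hb]
  zero_mem' := by simp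
  smul_mem' c x hx := by
    show (c • x)ᴴ = c • x
    rw [Matrix.conjTranspose_smul, show xᴴ = x from hx]; simp

theorem mem_hermS {H : Matrix m m ℂ} : H ∈ hermS m ↔ Hᴴ = H := Iff.rfl

theorem finrank_su [Nonempty m] :
    Module.finrank ℝ (suAlgebra m) ≤ Fintype.card m ^ 2 - 1 := by
  -- the map `(H, t) ↦ I • H + t • 1` into Hermitian matrices, and pairs
  let f : ((suAlgebra m × ℝ) × (suAlgebra m × ℝ)) →ₗ[ℝ] Matrix m m ℂ :=
    LinearMap.coprod
      (LinearMap.coprod (suAlgebra m).subtype (LinearMap.toSpanSingleton ℝ _ (Complex.I • 1)))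
      (LinearMap.coprod ((LinearMap.lsmul ℂ (Matrix m m ℂ) Complex.I).restrictScalars ℝ ∘ₗ
        (suAlgebra m).subtype) (LinearMap.toSpanSingleton ℝ _ 1))
  have hf : ∀ q, f q = (q.1.1 : Matrix m m ℂ) + q.1.2 • (Complex.I • (1 : Matrix m m ℂ)) +
    (Complex.I • (q.2.1 : Matrix m m ℂ) + q.2.2 • (1 : Matrix m m ℂ)) := fun q => rfl
  have hinj : Function.Injective f := by
    rw [← LinearMap.ker_eq_bot, LinearMap.ker_eq_bot']
    rintro ⟨⟨⟨A, hA⟩, s⟩, ⟨⟨B, hB⟩, t⟩⟩ h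
    rw [hf] at h
    simp only at h
    obtain ⟨hA1, hA2⟩ := mem_su.1 hA
    obtain ⟨hB1, hB2⟩ := mem_su.1 hB
    have htr := congrArg Matrix.trace h
    simp only [Matrix.trace_add, Matrix.trace_smul, hA2, hB2, Matrix.trace_one,
      Matrix.trace_zero] at htr
    have hc : (Fintype.card m : ℝ) ≠ 0 := by simp
    have hs : s = 0 := by
      have := congrArg Complex.im htr
      simpa [hc] using this
    have ht : t = 0 := by
      have := congrArg Complex.re htr
      simpa [hc] using this
    subst hs ht
    simp only [zero_smul, add_zero] at h
    have h2 := congrArg Matrix.conjTranspose h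
    rw [Matrix.conjTranspose_add, Matrix.conjTranspose_smul, hA1, hB1] at h2
    simp at h2
    have hA0 : A = 0 := by
      have : (2 : ℂ) • A = 0 := by
        have h3 : A + A = (A + Complex.I • B) - (-A + Complex.I • B) := by abel
        rw [two_smul, h3, h, h2]; simp
      simpa using this
    have hB0 : B = 0 := by
      rw [hA0, zero_add] at h
      simpa using h
    subst hA0 hB0
    rfl
  have h1 := LinearMap.finrank_le_finrank_of_injective hinj
  have h2 : Module.finrank ℝ (Matrix m m ℂ) = Fintype.card m ^ 2 * 2 := by
    rw [Module.finrank_matrix, Complex.finrank_real_complex]; ring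
  rw [h2] at h1
  simp only [Module.finrank_prod, Module.finrank_self] at h1
  omega

end dims

theorem finrank_su2 : Module.finrank ℝ (suAlgebra (Fin 2)) = 3 := by
  apply le_antisymm
  · simpa using finrank_su (Fin 2)
  · let g : (Fin 3 → ℝ) →ₗ[ℝ] M2 :=
      { toFun := fun v => !![v 0 * Complex.I, v 1 + v 2 * Complex.I;
          -v 1 + v 2 * Complex.I, -(v 0) * Complex.I]
        map_add' := by
          intro v w
          ext i j; fin_cases i <;> fin_cases j <;> simp <;> ring
        map_smul' := by
          intro r v
          ext i j; fin_cases i <;> fin_cases j <;> simp <;> ring }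
    have hg : ∀ v, g v ∈ suAlgebra (Fin 2) := by
      intro v
      rw [mem_su]
      refine ⟨?_, ?_⟩
      · ext i j
        fin_cases i <;> fin_cases j <;> simp [g, Matrix.conjTranspose_apply] <;> ring
      · simp [g, Matrix.trace_fin_two]
    have hi : Function.Injective (g.codRestrict _ hg) := by
      rw [← LinearMap.ker_eq_bot, LinearMap.ker_eq_bot']
      intro v hv
      have hv' : g v = 0 := congrArg Subtype.val hv
      have h0 := congrFun (congrFun hv' 0) 0
      have h1 := congrFun (congrFun hv' 0) 1
      simp [g] at h0 h1
      have e1 := congrArg Complex.re h1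
      have e2 := congrArg Complex.im h1
      simp at e1 e2
      ext i; fin_cases i <;> simp [h0, e1, e2]
    simpa using LinearMap.finrank_le_finrank_of_injective hi

/-- existence of the 9-dimensional slice -/
theorem exists_slice : ∃ S : Submodule ℝ M4, S ≤ suAlgebra (Fin 4) ∧
    suAlgebra (Fin 4) ≤ S ⊔ LinearMap.range kK ∧ Module.finrank ℝ S ≤ 9 := by
  have hr : LinearMap.range kK ≤ suAlgebra (Fin 4) := by
    rintro _ ⟨Y, rfl⟩
    rw [kK_apply]
    exact add_mem (kL_su Y.1.2) (kR_su Y.2.2)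
  obtain ⟨q, hq⟩ := Submodule.exists_isCompl (LinearMap.range kK)
  refine ⟨q ⊓ suAlgebra (Fin 4), inf_le_right, ?_, ?_⟩
  · intro x hx
    have : x ∈ LinearMap.range kK ⊔ q := by rw [hq.sup_eq_top]; trivial
    obtain ⟨a, ha, b, hb, rfl⟩ := Submodule.mem_sup.1 this
    refine Submodule.mem_sup.2 ⟨b, ⟨hb, ?_⟩, a, ha, add_comm _ _⟩
    have := sub_mem hx (hr ha)
    simpa using this
  · have h1 : Module.finrank ℝ (LinearMap.range kK) = 6 := by
      rw [LinearMap.finrank_range_of_inj kK_inj, Module.finrank_prod, finrank_su2]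
    have h2 := Submodule.finrank_sup_add_finrank_inf_eq (LinearMap.range kK)
      (q ⊓ suAlgebra (Fin 4))
    have h3 : LinearMap.range kK ⊔ q ⊓ suAlgebra (Fin 4) ≤ suAlgebra (Fin 4) :=
      sup_le hr inf_le_right
    have h4 := Submodule.finrank_mono h3
    have h5 : Module.finrank ℝ (suAlgebra (Fin 4)) ≤ 15 := by simpa using finrank_su (Fin 4)
    have h6 : LinearMap.range kK ⊓ (q ⊓ suAlgebra (Fin 4)) = ⊥ := by
      rw [← inf_assoc, hq.inf_eq_bot, bot_inf_eq]
    rw [h6, finrank_bot] at h2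
    have h7 := h4.trans h5
    omega

end BW

namespace BW
open scoped Matrix.Norms.L2Operator
set_option synthInstance.maxSize 4000
set_option synthInstance.maxHeartbeats 200000

abbrev SU2set : Set M2 := {k | k ∈ Matrix.specialUnitaryGroup (Fin 2) ℂ}

theorem kLR (k l : M2) : kL k * kR l = kron2 k l := by
  show kron2 k 1 * kron2 1 l = _
  rw [kron2_mul]; simp

theorem herm_exp_one {H : M4} (hH : Hᴴ = H) (h : NormedSpace.exp (H + H) = 1) : H = 0 := by
  obtain ⟨V, d, h1, h2, h3⟩ := herm_diag (A := H) hH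
  have e : H + H = V * Matrix.diagonal (fun i => (d i : ℂ) + d i) * star V := by
    rw [← Matrix.diagonal_add, mul_add, add_mul, ← h3]
  rw [e, exp_conj_diag h1 h2] at h
  have h4 : Matrix.diagonal (fun i => Complex.exp ((d i : ℂ) + d i)) = (1 : M4) := by
    have := congrArg (fun M => star V * M * V) h
    simp only [mul_assoc, h1, mul_one] at this
    rw [← mul_assoc, h1, one_mul] at this
    exact this
  have hd : d = 0 := by
    ext i
    have := congrFun (congrFun h4 i) i
    rw [Matrix.diagonal_apply_eq, Matrix.one_apply_eq, ← Complex.ofReal_add, ← Complex.ofReal_exp] at this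
    have h5 : Real.exp (d i + d i) = 1 := by exact_mod_cast this
    rw [Real.exp_eq_one_iff] at h5
    simp; linarith
  rw [h3, hd]; simp

theorem scal_eq (θ : ℝ) : NormedSpace.exp ((θ : ℂ) • (Complex.I • (1 : M4))) =
    Complex.exp (θ * Complex.I) • 1 := by
  rw [smul_smul, Matrix.smul_one_eq_diagonal, Matrix.exp_diagonal, Matrix.smul_one_eq_diagonal]
  congr 1
  rw [Pi.exp_def, Complex.exp_eq_exp_ℂ]

/-- If `exp (H + iθ)` is in `SU(4)` with `H` Hermitian and `θ` small then it is `1`. -/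
theorem transverse {H : M4} (hH : Hᴴ = H) {θ : ℝ} (hθ : |θ| < 1)
    (h : NormedSpace.exp (H + (θ : ℂ) • (Complex.I • (1 : M4))) ∈
      Matrix.specialUnitaryGroup (Fin 4) ℂ) :
    NormedSpace.exp (H + (θ : ℂ) • (Complex.I • (1 : M4))) = 1 := by
  have hcomm : Commute H ((θ : ℂ) • (Complex.I • (1 : M4))) := by
    show _ * _ = _ * _
    simp
  have hsplit := Matrix.exp_add_of_commute _ _ hcomm
  rw [scal_eq] at hsplit
  rw [Matrix.mem_specialUnitaryGroup_iff, Matrix.mem_unitaryGroup_iff] at h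
  have hu := h.1
  rw [hsplit, Matrix.star_eq_conjTranspose, Matrix.conjTranspose_mul, ← Matrix.exp_conjTranspose,
    hH] at hu
  have hH0 : H = 0 := by
    apply herm_exp_one hH
    rw [Matrix.exp_add_of_commute _ _ (Commute.refl H), ← hu]
    simp only [Matrix.conjTranspose_smul, Matrix.conjTranspose_one, Matrix.mul_smul,
      Matrix.smul_mul, mul_one, one_mul, smul_smul, Complex.star_def, ← Complex.exp_conj,
      ← Complex.exp_add]
    simp
  have hd := h.2
  rw [hsplit, hH0, NormedSpace.exp_zero, one_mul, Matrix.det_smul, Matrix.det_one, mul_one,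
    Fintype.card_fin, ← Complex.exp_nat_mul, Complex.exp_eq_one_iff] at hd
  obtain ⟨k, hk⟩ := hd
  have hk2 : 4 * θ = k * (2 * Real.pi) := by
    have := congrArg Complex.im hk
    simpa using this
  have hk0 : k = 0 := by
    by_contra hne
    have h1 : (1:ℝ) ≤ |(k:ℝ)| := by
      rw [← Int.cast_abs]; exact_mod_cast Int.one_le_abs hne
    have h2 : |4 * θ| = |(k:ℝ)| * (2 * Real.pi) := by
      rw [hk2, abs_mul, abs_of_pos Real.two_pi_pos]
    rw [abs_mul] at h2
    have h3 := Real.pi_gt_three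
    norm_num at h2
    nlinarith
  rw [hk0] at hk2
  have : θ = 0 := by simpa using hk2
  rw [hsplit, hH0, this]; simp

/-- the local parametrization -/
noncomputable def locPar (S : Submodule ℝ M4)
    (q : (S × (suAlgebra (Fin 2) × suAlgebra (Fin 2))) × (hermS (Fin 4) × ℝ)) : M4 :=
  NormedSpace.exp (q.1.1 : M4) * (kL (NormedSpace.exp (q.1.2.1 : M2)) *
    kR (NormedSpace.exp (q.1.2.2 : M2))) *
    NormedSpace.exp ((q.2.1 : M4) + (q.2.2 : ℂ) • (Complex.I • (1 : M4)))

theorem locPar_nhds (S : Submodule ℝ M4) (hS : suAlgebra (Fin 4) ≤ S ⊔ LinearMap.range kK) :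
    Filter.map (locPar S) (nhds 0) = nhds 1 := by
  let E := (S × (suAlgebra (Fin 2) × suAlgebra (Fin 2))) × (hermS (Fin 4) × ℝ)
  let a1 : E →L[ℝ] M4 := LinearMap.toContinuousLinearMap
    (S.subtype ∘ₗ LinearMap.fst ℝ _ _ ∘ₗ LinearMap.fst ℝ _ _)
  let a2 : E →L[ℝ] M2 := LinearMap.toContinuousLinearMap
    ((suAlgebra (Fin 2)).subtype ∘ₗ LinearMap.fst ℝ _ _ ∘ₗ LinearMap.snd ℝ _ _ ∘ₗ
      LinearMap.fst ℝ _ _)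
  let a3 : E →L[ℝ] M2 := LinearMap.toContinuousLinearMap
    ((suAlgebra (Fin 2)).subtype ∘ₗ LinearMap.snd ℝ _ _ ∘ₗ LinearMap.snd ℝ _ _ ∘ₗ
      LinearMap.fst ℝ _ _)
  let a4 : E →L[ℝ] M4 := LinearMap.toContinuousLinearMap
    (((hermS (Fin 4)).subtype.coprod (LinearMap.toSpanSingleton ℝ _ (Complex.I • (1 : M4)))) ∘ₗ
      LinearMap.snd ℝ _ _)
  let kL' : M2 →L[ℝ] M4 := LinearMap.toContinuousLinearMap kL
  let kR' : M2 →L[ℝ] M4 := LinearMap.toContinuousLinearMap kR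
  have e4 : ∀ (a : E →L[ℝ] M4), HasStrictFDerivAt (fun q => NormedSpace.exp (a q)) a 0 := by
    intro a
    have h := (hasStrictFDerivAt_exp_zero (𝕂 := ℝ) (𝔸 := M4))
    have h' : HasStrictFDerivAt (NormedSpace.exp : M4 → M4) (1 : M4 →L[ℝ] M4) (a 0) := by
      rw [map_zero]; exact h
    exact h'.comp (0 : E) a.hasStrictFDerivAt
  have e2 : ∀ (a : E →L[ℝ] M2), HasStrictFDerivAt (fun q => NormedSpace.exp (a q)) a 0 := by
    intro a
    have h := (hasStrictFDerivAt_exp_zero (𝕂 := ℝ) (𝔸 := M2))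
    have h' : HasStrictFDerivAt (NormedSpace.exp : M2 → M2) (1 : M2 →L[ℝ] M2) (a 0) := by
      rw [map_zero]; exact h
    exact h'.comp (0 : E) a.hasStrictFDerivAt
  have d2 : HasStrictFDerivAt (fun q => kL' (NormedSpace.exp (a2 q))) (kL'.comp a2) 0 :=
    kL'.hasStrictFDerivAt.comp (0 : E) (e2 a2)
  have d3 : HasStrictFDerivAt (fun q => kR' (NormedSpace.exp (a3 q))) (kR'.comp a3) 0 :=
    kR'.hasStrictFDerivAt.comp (0 : E) (e2 a3)
  have d := ((e4 a1).mul' (d2.mul' d3)).mul' (e4 a4)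
  have hkL1 : kL' (NormedSpace.exp (a2 0)) = 1 := by
    rw [map_zero, NormedSpace.exp_zero]; exact kron2_one
  have hkR1 : kR' (NormedSpace.exp (a3 0)) = 1 := by
    rw [map_zero, NormedSpace.exp_zero]; exact kron2_one
  have hloc0 : locPar S 0 = 1 := by
    have : locPar S 0 = NormedSpace.exp (a1 0) * (kL' (NormedSpace.exp (a2 0)) *
      kR' (NormedSpace.exp (a3 0))) * NormedSpace.exp (a4 0) := rfl
    rw [this, hkL1, hkR1, map_zero, map_zero, NormedSpace.exp_zero]; simp
  have := HasStrictFDerivAt.map_nhds_eq_of_surj d ?_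
  · rw [← hloc0]; exact this
  · rw [LinearMap.range_eq_top]
    intro M
    let A : M4 := (1/2 : ℂ) • (M + Mᴴ)
    let B : M4 := (1/2 : ℂ) • (M - Mᴴ)
    have hAB : A + B = M := by
      simp only [A, B, ← smul_add]
      rw [show M + Mᴴ + (M - Mᴴ) = (2:ℂ) • M by rw [two_smul]; abel, smul_smul]; norm_num
    have hA : Aᴴ = A := by
      simp only [A, Matrix.conjTranspose_smul, Matrix.conjTranspose_add,
        Matrix.conjTranspose_conjTranspose]
      rw [add_comm]; simp
    have hB : Bᴴ = -B := by
      simp only [B, Matrix.conjTranspose_smul, Matrix.conjTranspose_sub,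
        Matrix.conjTranspose_conjTranspose]
      rw [← smul_neg, neg_sub]; simp
    let θ : ℝ := B.trace.im / 4
    have htB : B.trace = (4 * θ : ℝ) * Complex.I := by
      have h1 : star B.trace = - B.trace := by
        rw [← Matrix.trace_conjTranspose, hB, Matrix.trace_neg]
      have h2 := congrArg Complex.re h1
      simp at h2
      apply Complex.ext
      · simp; linarith
      · simp [θ]; ring
    have hC : B - (θ : ℂ) • (Complex.I • (1 : M4)) ∈ suAlgebra (Fin 4) := by
      rw [mem_su]
      refine ⟨?_, ?_⟩
      · rw [Matrix.conjTranspose_sub, hB]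
        simp [sub_eq_add_neg, add_comm]
      · rw [Matrix.trace_sub, htB]
        simp; ring
    obtain ⟨X, hX, Z, ⟨Y, rfl⟩, hXZ⟩ := Submodule.mem_sup.1 (hS hC)
    refine ⟨((⟨X, hX⟩, Y), (⟨A, hA⟩, θ)), ?_⟩
    have q1 : a1 ((⟨X, hX⟩, Y), (⟨A, hA⟩, θ)) = X := rfl
    have q2 : kL' (a2 ((⟨X, hX⟩, Y), (⟨A, hA⟩, θ))) = kL Y.1 := rfl
    have q3 : kR' (a3 ((⟨X, hX⟩, Y), (⟨A, hA⟩, θ))) = kR Y.2 := rfl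
    have q4 : a4 ((⟨X, hX⟩, Y), (⟨A, hA⟩, θ)) = A + (θ : ℂ) • (Complex.I • (1 : M4)) := rfl
    have hKY : kK Y = kL Y.1 + kR Y.2 := rfl
    simp only [ContinuousLinearMap.coe_coe, ContinuousLinearMap.add_apply,
      ContinuousLinearMap.smul_apply, ContinuousLinearMap.comp_apply, MulOpposite.op_mul,
      hkL1, hkR1, q1, q2, q3, q4]
    simp only [map_zero, NormedSpace.exp_zero, mul_one, one_smul, MulOpposite.op_one]
    have hB2 : B = X + kK Y + (θ : ℂ) • (Complex.I • (1 : M4)) := by rw [hXZ]; abel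
    rw [← hAB, hB2, hKY]
    have w1 : kL' 1 = 1 := kron2_one
    have w2 : kR' 1 = 1 := kron2_one
    simp only [Pi.mul_apply, map_zero, NormedSpace.exp_zero, w1, w2, one_smul, mul_one,
      MulOpposite.op_one]
    abel

theorem slice_nhds (S : Submodule ℝ M4) (hS1 : S ≤ suAlgebra (Fin 4))
    (hS : suAlgebra (Fin 4) ≤ S ⊔ LinearMap.range kK) :
    {u : SU4 | ∃ X ∈ S, ∃ k ∈ SU2set, ∃ l ∈ SU2set,
      (u : M4) = NormedSpace.exp X * kron2 k l} ∈ nhds (1 : SU4) := by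
  have h1 : (locPar S) '' {q | |q.2.2| < 1} ∈ nhds (1 : M4) := by
    rw [← locPar_nhds S hS]
    apply Filter.image_mem_map
    apply IsOpen.mem_nhds
    · exact isOpen_lt (by fun_prop) continuous_const
    · simp
  have h2 : ((↑) : SU4 → M4) ⁻¹' ((locPar S) '' {q | |q.2.2| < 1}) ∈ nhds (1 : SU4) :=
    continuous_subtype_val.continuousAt.preimage_mem_nhds (by simpa using h1)
  refine Filter.mem_of_superset h2 ?_
  rintro u ⟨⟨⟨X, Y1, Y2⟩, ⟨H, θ⟩⟩, hθ, hu⟩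
  have hk1 := exp_mem_SU Y1.2
  have hk2 := exp_mem_SU Y2.2
  have hX := exp_mem_SU (hS1 X.2)
  refine ⟨X, X.2, _, hk1, _, hk2, ?_⟩
  have hu' : NormedSpace.exp (X : M4) * kron2 (NormedSpace.exp (Y1 : M2))
    (NormedSpace.exp (Y2 : M2)) *
    NormedSpace.exp ((H : M4) + (θ : ℂ) • (Complex.I • (1 : M4))) = u := by
    rw [← hu, locPar, kLR]
  set g := NormedSpace.exp (X : M4) * kron2 (NormedSpace.exp (Y1 : M2))
    (NormedSpace.exp (Y2 : M2)) with hg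
  have hgm : g ∈ Matrix.specialUnitaryGroup (Fin 4) ℂ := mul_mem hX (kron2_mem hk1 hk2)
  have hgs : star g * g = 1 := (Matrix.mem_specialUnitaryGroup_iff.1 hgm).1.1
  have hW : NormedSpace.exp ((H : M4) + (θ : ℂ) • (Complex.I • (1 : M4))) = star g * u := by
    rw [← hu', ← mul_assoc, hgs, one_mul]
  have := transverse H.2 hθ (by rw [hW]; exact mul_mem (SU4.star_mem hgm) u.2)
  rw [this, mul_one] at hu'
  exact hu'.symm

theorem exists_cover : ∃ (S : Submodule ℝ M4) (J : Finset SU4), Module.finrank ℝ S ≤ 9 ∧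
    S ≤ suAlgebra (Fin 4) ∧
    ∀ u ∈ Matrix.specialUnitaryGroup (Fin 4) ℂ, ∃ c ∈ J, ∃ X ∈ S, ∃ k ∈ SU2set, ∃ l ∈ SU2set,
      u = (c : M4) * NormedSpace.exp X * kron2 k l := by
  obtain ⟨S, h1, h2, h3⟩ := exists_slice
  have h4 := slice_nhds S h1 h2
  set O := {u : SU4 | ∃ X ∈ S, ∃ k ∈ SU2set, ∃ l ∈ SU2set,
      (u : M4) = NormedSpace.exp X * kron2 k l} with hO
  obtain ⟨J, -, hJ⟩ := (isCompact_univ (X := SU4)).elim_nhds_subcover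
    (fun c => {u | c⁻¹ * u ∈ O}) (by
      intro c _
      have : Continuous fun u : SU4 => c⁻¹ * u := by fun_prop
      exact this.continuousAt.preimage_mem_nhds (by simpa using h4))
  refine ⟨S, J, h3, h1, ?_⟩
  intro u hu
  have := hJ (Set.mem_univ (⟨u, hu⟩ : SU4))
  simp only [Set.mem_iUnion] at this
  obtain ⟨c, hc, X, hX, k, hk, l, hl, h⟩ := this
  refine ⟨c, hc, X, hX, k, hk, l, hl, ?_⟩
  rw [mul_assoc, ← h]
  have : (⟨u, hu⟩ : SU4) = c * (c⁻¹ * ⟨u, hu⟩) := by simp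
  exact congrArg Subtype.val this

end BW

namespace BW

/-- partial circuit products -/
noncomputable def PP {n : ℕ} (p : ℕ → Fin n × Fin n) (y : ℕ → M4) : ℕ → NMatrix n
  | 0 => 1
  | k + 1 => embedGate (p k) (y k) * PP p y k

theorem PP_congr {n : ℕ} (p : ℕ → Fin n × Fin n) {x y : ℕ → M4} (k : ℕ)
    (h : ∀ j < k, x j = y j) : PP p x k = PP p y k := by
  induction k with
  | zero => rfl
  | succ k ih => rw [PP, PP, ih (fun j hj => h j (by omega)), h k (by omega)]

theorem contract_eq {n : ℕ} (p : ℕ → Fin n × Fin n) (y : ℕ → M4) :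
    ∀ (R : ℕ) (A : Architecture n R) (x : Fin R → SU4), (∀ i : Fin R, (A i).1 = p i) →
    (∀ i : Fin R, (x i : M4) = y i) → contract A x = PP p y R := by
  intro R
  induction R with
  | zero => intro A x _ _; simp [contract, gateList, PP]
  | succ R ih =>
    intro A x hA hx
    have := ih (fun i => A i.castSucc) (fun i => x i.castSucc) (fun i => hA i.castSucc)
      (fun i => hx i.castSucc)
    rw [PP, ← this]
    simp only [contract, gateList]
    rw [List.ofFn_succ']
    simp only [List.concat_eq_append, List.reverse_append, List.reverse_singleton,
      List.singleton_append, List.prod_cons]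
    have h1 := hA (Fin.last R)
    have h2 := hx (Fin.last R)
    simp only [Fin.val_last] at h1 h2
    rw [h1, h2]

theorem gauge_push {n : ℕ} (p : ℕ → Fin n × Fin n) (S : Submodule ℝ M4) (J : Finset SU4)
    (hJ : ∀ u ∈ Matrix.specialUnitaryGroup (Fin 4) ℂ, ∃ c ∈ J, ∃ X ∈ S, ∃ k ∈ SU2set,
      ∃ l ∈ SU2set, u = (c : M4) * NormedSpace.exp X * kron2 k l) (y : ℕ → M4)
    (hy : ∀ j, y j ∈ Matrix.specialUnitaryGroup (Fin 4) ℂ) (R : ℕ)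
    (hp : ∀ j < R, (p j).1 ≠ (p j).2) :
    ∀ κ : Fin n → M2, (∀ i, κ i ∈ SU2set) → ∃ (c : ℕ → SU4) (X : ℕ → M4) (κ' : Fin n → M2),
      (∀ j < R, c j ∈ J) ∧ (∀ j, X j ∈ S) ∧ (∀ i, κ' i ∈ SU2set) ∧
      locM κ * PP p y R = PP p (fun j => (c j : M4) * NormedSpace.exp (X j)) R * locM κ' := by
  induction R with
  | zero =>
    intro κ hκ
    exact ⟨fun _ => 1, fun _ => 0, κ, by simp, fun _ => zero_mem _, hκ, by simp [PP]⟩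
  | succ R ih =>
    intro κ hκ
    have hpR := hp R (by omega)
    obtain ⟨c, hc, X, hX, k, hk, l, hl, hu⟩ :=
      hJ (kron2 (κ (p R).1) (κ (p R).2) * y R) (mul_mem (kron2_mem (hκ _) (hκ _)) (hy R))
    obtain ⟨c', X', κ', h1, h2, h3, h4⟩ := ih (fun j hj => hp j (by omega))
      (upd (p R) κ k l) (by
        intro i
        by_cases hi2 : i = (p R).2
        · rw [hi2, upd_snd]; exact hl
        by_cases hi1 : i = (p R).1
        · rw [hi1, upd_fst hpR]; exact hk
        · rw [upd_of_ne _ _ _ hi1 hi2]; exact hκ i)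
    refine ⟨Function.update c' R c, Function.update X' R X, κ', ?_, ?_, h3, ?_⟩
    · intro j hj
      by_cases hjR : j = R
      · subst hjR; simpa using hc
      · rw [Function.update_of_ne hjR]; exact h1 j (by omega)
    · intro j
      by_cases hjR : j = R
      · subst hjR; simpa using hX
      · rw [Function.update_of_ne hjR]; exact h2 j
    · rw [PP, PP]
      rw [PP_congr p (x := fun j => ((Function.update c' R c j : SU4) : M4) *
        NormedSpace.exp (Function.update X' R X j))
        (y := fun j => (c' j : M4) * NormedSpace.exp (X' j)) R (by
          intro j hj
          simp only [Function.update_of_ne (show j ≠ R by omega)])]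
      simp only [Function.update_self]
      rw [mul_assoc (embedGate (p R) _) _ (locM κ'), ← h4]
      conv_lhs => rw [← upd_self (p := p R) κ]
      rw [locM_split hpR κ (κ (p R).1) (κ (p R).2), locM_split hpR κ k l, ← mul_assoc, ← mul_assoc, mul_assoc (embedGate _ _)
        (locM _) (embedGate _ _), ← locM_comm hpR, ← mul_assoc, ← embed_mul hpR, hu,
        embed_mul hpR]
      simp only [mul_assoc]

section smooth
set_option synthInstance.maxSize 4000
set_option synthInstance.maxHeartbeats 200000
open scoped Matrix.Norms.L2Operator
open scoped ContDiff

variable {E : Type*} [NormedAddCommGroup E] [NormedSpace ℝ E]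

theorem contDiff_matrix {m : Type*} [Fintype m] [DecidableEq m] {N : WithTop ℕ∞}
    (f : E → Matrix m m ℂ) (h : ∀ a b, ContDiff ℝ N fun e => f e a b) : ContDiff ℝ N f := by
  have h2 : ContDiff ℝ N (fun e => (fun a b => f e a b : m → m → ℂ)) :=
    contDiff_pi.2 fun a => contDiff_pi.2 fun b => h a b
  let ℓ : (m → m → ℂ) →L[ℝ] Matrix m m ℂ :=
    LinearMap.toContinuousLinearMap (Matrix.ofLinearEquiv ℝ).toLinearMap
  exact ℓ.contDiff.comp h2

theorem contDiff_exp {m : Type*} [Fintype m] [DecidableEq m] {N : WithTop ℕ∞} :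
    ContDiff ℝ N (NormedSpace.exp : Matrix m m ℂ → Matrix m m ℂ) := by
  have h : AnalyticOnNhd ℝ (NormedSpace.exp : Matrix m m ℂ → Matrix m m ℂ) Set.univ :=
    fun x _ => NormedSpace.exp_analytic x
  exact h.contDiff

theorem contDiff_PP {n : ℕ} (p : ℕ → Fin n × Fin n) {N : WithTop ℕ∞} (y : E → ℕ → M4)
    (hy : ∀ j, ContDiff ℝ N fun e => y e j) (k : ℕ) : ContDiff ℝ N fun e => PP p (y e) k := by
  induction k with
  | zero => exact contDiff_const
  | succ k ih =>
    let ℓ : M4 →L[ℝ] NMatrix n := LinearMap.toContinuousLinearMap (embedLin (p k))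
    have h1 : ContDiff ℝ N fun e => ℓ (y e k) := ℓ.contDiff.comp (hy k)
    exact h1.mul ih

theorem contDiff_entry {m : Type*} [Fintype m] [DecidableEq m] {N : WithTop ℕ∞}
    (f : E → Matrix m m ℂ) (h : ContDiff ℝ N f) (a b : m) : ContDiff ℝ N fun e => f e a b := by
  let ℓ : Matrix m m ℂ →L[ℝ] ℂ := LinearMap.toContinuousLinearMap (Matrix.entryLinearMap ℝ ℂ a b)
  exact ℓ.contDiff.comp h

theorem contDiff_locM {n : ℕ} {N : WithTop ℕ∞} (κ : E → Fin n → M2)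
    (h : ∀ i, ContDiff ℝ N fun e => κ e i) : ContDiff ℝ N fun e => locM (κ e) := by
  apply contDiff_matrix
  intro a b
  exact contDiff_prod fun i _ => contDiff_entry _ (h i) _ _

theorem null_of_dim [FiniteDimensional ℝ E] {d : ℕ} (f : E → (Fin d → ℝ)) (hf : ContDiff ℝ 1 f)
    (hd : Module.finrank ℝ E < d) : volume (Set.range f) = 0 := by
  have h1 := hf.dimH_range_le
  have h2 : Measure.hausdorffMeasure (d : ℝ) (Set.range f) = 0 := by
    have := hausdorffMeasure_of_dimH_lt (s := Set.range f) (d := (d : NNReal))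
      (h1.trans_lt (by exact_mod_cast hd))
    simpa using this
  have h3 : (Measure.hausdorffMeasure (Fintype.card (Fin d) : ℝ) : Measure (Fin d → ℝ)) = volume :=
    hausdorffMeasure_pi_real
  rw [← h3]; simpa using h2

/-- images of short circuits have null projections -/
theorem null_short {n R d : ℕ} (hn : 2 ≤ n) (A : Architecture n R) (hd : 9 * R + 3 * n < d)
    (π : NMatrix n →ₗ[ℝ] (Fin d → ℝ)) : volume (π '' Set.range (contract A)) = 0 := by
  obtain ⟨S, J, hS9, hS, hJ⟩ := exists_cover
  let p : ℕ → Fin n × Fin n := fun i =>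
    if h : i < R then (A ⟨i, h⟩).1 else (⟨0, by omega⟩, ⟨1, by omega⟩)
  have hpA : ∀ i : Fin R, (A i).1 = p i := fun i => by simp [p]
  have hp : ∀ j < R, (p j).1 ≠ (p j).2 := by
    intro j hj
    simp only [p, hj, dif_pos]; exact (A ⟨j, hj⟩).2
  let F := (Fin R → S) × (Fin n → suAlgebra (Fin 2))
  let Θ : (Fin R → J) → F → NMatrix n := fun c q =>
    PP p (fun j => if h : j < R then ((c ⟨j, h⟩ : SU4) : M4) * NormedSpace.exp (q.1 ⟨j, h⟩ : M4)
      else 1) R * locM (fun i => NormedSpace.exp (q.2 i : M2))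
  have hsub : Set.range (contract A) ⊆ ⋃ c, Set.range (Θ c) := by
    rintro _ ⟨x, rfl⟩
    let y : ℕ → M4 := fun j => if h : j < R then x ⟨j, h⟩ else 1
    have hy : ∀ j, y j ∈ Matrix.specialUnitaryGroup (Fin 4) ℂ := by
      intro j
      simp only [y]
      split_ifs
      · exact (x _).2
      · exact one_mem _
    rw [contract_eq p y R A x hpA (fun i => by simp [y])]
    obtain ⟨c, X, κ', h1, h2, h3, h4⟩ := gauge_push p S J hJ y hy R hp (fun _ => 1)
      (fun _ => show (1 : M2) ∈ Matrix.specialUnitaryGroup (Fin 2) ℂ from one_mem _)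
    rw [locM_one, one_mul] at h4
    choose Y hY1 hY2 using fun i => exp_surj (h3 i)
    refine Set.mem_iUnion.2 ⟨fun j => ⟨c j, h1 j j.2⟩,
      ⟨(fun j => ⟨X j, h2 j⟩, fun i => ⟨Y i, hY1 i⟩), ?_⟩⟩
    rw [h4]
    simp only [Θ, hY2]
    congr 1
    apply PP_congr
    intro j hj
    simp [hj]
  have hπ : π '' Set.range (contract A) ⊆ ⋃ c, Set.range (fun q => π (Θ c q)) := by
    rintro _ ⟨M, hM, rfl⟩
    obtain ⟨c, q, rfl⟩ := Set.mem_iUnion.1 (hsub hM)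
    exact Set.mem_iUnion.2 ⟨c, q, rfl⟩
  refine measure_mono_null hπ (measure_iUnion_null fun c => ?_)
  haveI : FiniteDimensional ℝ S := inferInstance
  haveI : FiniteDimensional ℝ (suAlgebra (Fin 2)) := inferInstance
  haveI : FiniteDimensional ℝ F := inferInstanceAs (FiniteDimensional ℝ ((Fin R → S) × (Fin n → suAlgebra (Fin 2))))
  apply null_of_dim
  · let π' : NMatrix n →L[ℝ] (Fin d → ℝ) := LinearMap.toContinuousLinearMap π
    refine π'.contDiff.comp (f := Θ c) ?_
    refine ContDiff.mul ?_ ?_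
    · apply contDiff_PP
      intro j
      by_cases hj : j < R
      · simp only [hj, dif_pos]
        refine contDiff_const.mul (contDiff_exp.comp ?_)
        exact (S.subtypeL.contDiff).comp ((contDiff_apply ℝ S (⟨j, hj⟩ : Fin R)).comp contDiff_fst)
      · simp only [hj, dif_neg, not_false_eq_true]; exact contDiff_const
    · apply contDiff_locM
      intro i
      refine contDiff_exp.comp ?_
      exact ((suAlgebra (Fin 2)).subtypeL.contDiff).comp
        ((contDiff_apply ℝ (suAlgebra (Fin 2)) i).comp contDiff_snd)
  · show Module.finrank ℝ ((Fin R → S) × (Fin n → suAlgebra (Fin 2))) < d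
    rw [Module.finrank_prod, Module.finrank_pi_fintype, Module.finrank_pi_fintype]
    simp only [finrank_su2, Finset.sum_const, Finset.card_univ, Fintype.card_fin, smul_eq_mul]
    nlinarith

end smooth
end BW

namespace BW

section assembly
open scoped Matrix.Norms.L2Operator
open scoped ContDiff
set_option synthInstance.maxSize 4000
set_option synthInstance.maxHeartbeats 200000

/-- derivative of partial circuit products -/
noncomputable def QQ {n : ℕ} (p : ℕ → Fin n × Fin n) (x H : ℕ → M4) : ℕ → NMatrix n
  | 0 => 0
  | k + 1 => embedGate (p k) (H k * x k) * PP p x k + embedGate (p k) (x k) * QQ p x H k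

theorem QQ_congr {n : ℕ} (p : ℕ → Fin n × Fin n) (x : ℕ → M4) {H H' : ℕ → M4} (k : ℕ)
    (h : ∀ j < k, H j = H' j) : QQ p x H k = QQ p x H' k := by
  induction k with
  | zero => rfl
  | succ k ih => rw [QQ, QQ, ih (fun j hj => h j (by omega)), h k (by omega)]

theorem Vsub_QQ {n : ℕ} (p : ℕ → Fin n × Fin n) (hp : ∀ j, (p j).1 ≠ (p j).2) (x : ℕ → M4)
    (hx : ∀ j, x j ∈ Matrix.specialUnitaryGroup (Fin 4) ℂ) (k : ℕ) :
    ∀ v ∈ Vsub p x k, ∃ H : ℕ → M4, (∀ j, H j ∈ suAlgebra (Fin 4)) ∧ v * PP p x k = QQ p x H k := by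
  induction k with
  | zero =>
    intro v hv
    rw [Vsub, Submodule.mem_bot] at hv
    exact ⟨fun _ => 0, fun _ => zero_mem _, by simp [hv, QQ]⟩
  | succ k ih =>
    intro v hv
    rw [Vsub] at hv
    obtain ⟨_, ⟨h, hh, rfl⟩, _, ⟨w, hw, rfl⟩, rfl⟩ := Submodule.mem_sup.1 hv
    obtain ⟨H, hH, hHw⟩ := ih w hw
    refine ⟨Function.update H k h, ?_, ?_⟩
    · intro j
      by_cases hj : j = k
      · subst hj; simpa using hh
      · rw [Function.update_of_ne hj]; exact hH j
    · rw [PP, QQ, QQ_congr p x (H' := H) k (fun j hj => Function.update_of_ne (by omega) _ _),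
        Function.update_self, ← hHw, embed_mul (hp k), Ad_apply]
      have hu := embed_unitary (hp k) (hx k)
      change (embedGate (p k) h + _) * _ = _
      rw [add_mul]
      congr 1
      · rw [mul_assoc]
      · calc embedGate (p k) (x k) * w * star (embedGate (p k) (x k)) *
              (embedGate (p k) (x k) * PP p x k)
            = embedGate (p k) (x k) * w * (star (embedGate (p k) (x k)) *
              embedGate (p k) (x k)) * PP p x k := by simp only [mul_assoc]
          _ = _ := by rw [hu]; simp only [mul_assoc, one_mul, mul_one]

theorem PP_unitary {n : ℕ} (p : ℕ → Fin n × Fin n) (hp : ∀ j, (p j).1 ≠ (p j).2) (x : ℕ → M4)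
    (hx : ∀ j, x j ∈ Matrix.specialUnitaryGroup (Fin 4) ℂ) (k : ℕ) :
    star (PP p x k) * PP p x k = 1 := by
  induction k with
  | zero => simp [PP]
  | succ k ih =>
    rw [PP, star_mul]
    calc _ = star (PP p x k) * (star (embedGate (p k) (x k)) * embedGate (p k) (x k)) *
          PP p x k := by simp only [mul_assoc]
      _ = 1 := by rw [embed_unitary (hp k) (hx k), mul_one, ih]

theorem hasDerivAt_PP {n : ℕ} (p : ℕ → Fin n × Fin n) (x H : ℕ → M4) (k : ℕ) :
    HasDerivAt (fun t : ℝ => PP p (fun j => NormedSpace.exp (t • H j) * x j) k) (QQ p x H k) 0 := by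
  induction k with
  | zero => exact hasDerivAt_const _ _
  | succ k ih =>
    let ℓ : M4 →L[ℝ] NMatrix n := LinearMap.toContinuousLinearMap (embedLin (p k))
    have h0 : HasDerivAt (fun t : ℝ => NormedSpace.exp (t • H k)) (H k) 0 := by
      have := hasDerivAt_exp_smul_const (𝕂 := ℝ) (H k) 0
      simpa using this
    have h1 : HasDerivAt (fun t : ℝ => ℓ (NormedSpace.exp (t • H k) * x k)) (ℓ (H k * x k)) 0 :=
      ℓ.hasFDerivAt.comp_hasDerivAt (0 : ℝ) (h0.mul_const (x k))
    have h2 := h1.mul ih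
    refine h2.congr_deriv ?_
    simp only [zero_smul, NormedSpace.exp_zero, one_mul]
    rfl

theorem exists_proj {V : Type*} [AddCommGroup V] [Module ℝ V] (W : Submodule ℝ V)
    [FiniteDimensional ℝ W] {T : ℕ} (h : T ≤ Module.finrank ℝ W) :
    ∃ π : V →ₗ[ℝ] (Fin T → ℝ), ∀ z, ∃ w ∈ W, π w = z := by
  let b := Module.finBasis ℝ W
  let g : W →ₗ[ℝ] (Fin T → ℝ) := LinearMap.funLeft ℝ ℝ (Fin.castLE h) ∘ₗ b.equivFun.toLinearMap
  have hg : Function.Surjective g :=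
    (LinearMap.funLeft_surjective_of_injective ℝ ℝ _ (Fin.castLE_injective h)).comp
      b.equivFun.surjective
  obtain ⟨π, hπ⟩ := g.exists_extend
  refine ⟨π, fun z => ?_⟩
  obtain ⟨w, hw⟩ := hg z
  refine ⟨w, w.2, ?_⟩
  rw [← hw, ← hπ]; rfl

instance : SecondCountableTopology SU4 := by
  haveI : SecondCountableTopology M4 := inferInstanceAs (SecondCountableTopology (Fin 4 → Fin 4 → ℂ))
  exact TopologicalSpace.Subtype.secondCountableTopology _

instance : haarSU4.IsMulLeftInvariant := by unfold haarSU4; infer_instance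

instance (R : ℕ) : (muSU4 R).IsMulLeftInvariant := by unfold muSU4; infer_instance
instance (R : ℕ) : IsProbabilityMeasure (muSU4 R) := by unfold muSU4; infer_instance

theorem continuous_PP {X : Type*} [TopologicalSpace X] {n : ℕ} (p : ℕ → Fin n × Fin n)
    (y : X → ℕ → M4) (hy : ∀ j, Continuous fun e => y e j) (k : ℕ) :
    Continuous fun e => PP p (y e) k := by
  induction k with
  | zero => exact continuous_const
  | succ k ih =>
    let ℓ : M4 →L[ℝ] NMatrix n := LinearMap.toContinuousLinearMap (embedLin (p k))
    have h1 : Continuous fun e => ℓ (y e k) := ℓ.continuous.comp (hy k)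
    exact h1.mul ih

/-- zero-extension of a tuple of gates -/
noncomputable def ext1 {R : ℕ} (x : Fin R → SU4) : ℕ → M4 :=
  fun j => if h : j < R then (x ⟨j, h⟩ : M4) else 1

theorem continuous_contract {n R : ℕ} (hn : 2 ≤ n) (A : Architecture n R) :
    Continuous (contract A) := by
  let p : ℕ → Fin n × Fin n := fun i =>
    if h : i < R then (A ⟨i, h⟩).1 else (⟨0, by omega⟩, ⟨1, by omega⟩)
  have h : contract A = fun x => PP p (ext1 x) R := by
    funext x
    exact contract_eq p _ R A x (fun i => by simp [p]) (fun i => by simp [ext1])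
  rw [h]
  apply continuous_PP
  intro j
  by_cases hj : j < R
  · simp only [ext1, hj, dif_pos]
    exact continuous_subtype_val.comp (continuous_apply _)
  · simp only [ext1, hj, dif_neg, not_false_eq_true]; exact continuous_const

theorem null_main {n R R' T : ℕ} (hn : 2 ≤ n) (p : ℕ → Fin n × Fin n)
    (hp : ∀ j, (p j).1 ≠ (p j).2) (A : Architecture n R) (hA : ∀ i : Fin R, (A i).1 = p i)
    (W : Submodule ℝ (NMatrix n)) (hW : Reach p R W) (hT : T ≤ Module.finrank ℝ W)
    (A' : Architecture n R') (hR : 9 * R' + 3 * n < T) :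
    muSU4 R {x | contract A x ∈ Set.range (contract A')} = 0 := by
  obtain ⟨x0, hx0⟩ := hW
  have hx0m : ∀ j, ((x0 j : SU4) : M4) ∈ Matrix.specialUnitaryGroup (Fin 4) ℂ := fun j => (x0 j).2
  set P := PP p (fun j => (x0 j : M4)) R with hP
  have hPu : star P * P = 1 := PP_unitary p hp _ hx0m R
  have hPu' : P * star P = 1 := mul_eq_one_comm.1 hPu
  let W' := W.map (LinearMap.mulRight ℝ P)
  have hinj : Function.Injective (LinearMap.mulRight ℝ P) := by
    intro a b hab
    simp only [LinearMap.mulRight_apply] at hab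
    have := congrArg (· * star P) hab
    simpa [mul_assoc, hPu'] using this
  have hW' : T ≤ Module.finrank ℝ W' := by
    rw [← (Submodule.equivMapOfInjective _ hinj W).finrank_eq]; exact hT
  obtain ⟨π, hπ⟩ := exists_proj W' hW'
  let π' : NMatrix n →L[ℝ] (Fin T → ℝ) := LinearMap.toContinuousLinearMap π
  let E0 := Fin R → suAlgebra (Fin 4)
  haveI : FiniteDimensional ℝ (suAlgebra (Fin 4)) := inferInstance
  let E := (Fin R → suAlgebra (Fin 4)) × (Fin R → suAlgebra (Fin 4))
  letI : MeasurableSpace E := borel E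
  haveI : BorelSpace E := ⟨rfl⟩
  haveI : FiniteDimensional ℝ E := inferInstanceAs (FiniteDimensional ℝ
    ((Fin R → suAlgebra (Fin 4)) × (Fin R → suAlgebra (Fin 4))))
  let μ : Measure E := Measure.addHaar
  have hZ : IsClosed {x | contract A x ∈ Set.range (contract A')} :=
    (isCompact_range (continuous_contract hn A')).isClosed.preimage (continuous_contract hn A)
  let φ : E → (Fin R → SU4) := fun e j =>
    ⟨NormedSpace.exp (e.1 j : M4), exp_mem_SU (e.1 j).2⟩ *
    ⟨NormedSpace.exp (e.2 j : M4), exp_mem_SU (e.2 j).2⟩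
  have hc1 : ∀ j, ContDiff ℝ ω fun e : E => NormedSpace.exp (e.1 j : M4) := fun j =>
    contDiff_exp.comp (((suAlgebra (Fin 4)).subtypeL.contDiff).comp
      ((contDiff_apply ℝ (suAlgebra (Fin 4)) j).comp contDiff_fst))
  have hc2 : ∀ j, ContDiff ℝ ω fun e : E => NormedSpace.exp (e.2 j : M4) := fun j =>
    contDiff_exp.comp (((suAlgebra (Fin 4)).subtypeL.contDiff).comp
      ((contDiff_apply ℝ (suAlgebra (Fin 4)) j).comp contDiff_snd))
  have hφ : Continuous φ := by
    refine continuous_pi fun j => ?_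
    exact Continuous.mul (Continuous.subtype_mk (hc1 j).continuous _)
      (Continuous.subtype_mk (hc2 j).continuous _)
  refine null_avg μ (muSU4 R) hZ φ hφ ?_
  intro g
  let yy : E → ℕ → M4 := fun e j => if h : j < R then
    NormedSpace.exp (e.1 ⟨j, h⟩ : M4) * (NormedSpace.exp (e.2 ⟨j, h⟩ : M4) * (g ⟨j, h⟩ : M4)) else 1
  let ψ : E → (Fin T → ℝ) := fun e => π' (PP p (yy e) R)
  have hcon : ∀ e, contract A (φ e * g) = PP p (yy e) R := by
    intro e
    apply contract_eq p _ R A _ hA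
    intro i
    simp only [yy, i.2, dif_pos, φ, Pi.mul_apply, mul_assoc, Fin.eta]
    rfl
  have hψC : ContDiff ℝ ω ψ := by
    refine π'.contDiff.comp (contDiff_PP p yy ?_ R)
    intro j
    by_cases hj : j < R
    · simp only [yy, hj, dif_pos]
      exact (hc1 _).mul ((hc2 _).mul contDiff_const)
    · simp only [yy, hj, dif_neg, not_false_eq_true]; exact contDiff_const
  have hsurj : ∀ j : Fin R, ∃ K ∈ suAlgebra (Fin 4), NormedSpace.exp K =
      ((x0 j * (g j)⁻¹ : SU4) : M4) := fun j => exp_surj (x0 j * (g j)⁻¹ : SU4).2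
  choose K hK1 hK2 using hsurj
  have hK3 : ∀ j : Fin R, NormedSpace.exp (K j) * (g j : M4) = (x0 j : M4) := by
    intro j
    rw [hK2]
    have : (x0 j * (g j)⁻¹) * g j = x0 j := by simp
    exact congrArg (fun z : SU4 => (z : M4)) this
  let e0 : E := (0, fun j => ⟨K j, hK1 j⟩)
  have hfd : Function.Surjective (fderiv ℝ ψ e0) := by
    intro z
    obtain ⟨w, ⟨v, hv, hvw⟩, hwz⟩ := hπ z
    obtain ⟨H, hH1, hH2⟩ := Vsub_QQ p hp _ hx0m R v (hx0 hv)
    let d : E := (fun j => ⟨H j, hH1 j⟩, 0)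
    refine ⟨d, ?_⟩
    have hdiff : HasFDerivAt ψ (fderiv ℝ ψ e0) (e0 + (0 : ℝ) • d) := by
      rw [zero_smul, add_zero]
      exact (hψC.differentiable (by simp) e0).hasFDerivAt
    have hline : HasDerivAt (fun t : ℝ => e0 + t • d) d 0 := by
      have := ((hasDerivAt_id (0 : ℝ)).smul_const d).const_add e0
      simpa using this
    have h1 := hdiff.comp_hasDerivAt (0 : ℝ) hline
    have h2 : HasDerivAt (fun t : ℝ => π' (PP p (fun j => NormedSpace.exp (t • H j) *
        (x0 j : M4)) R)) (π' (QQ p (fun j => (x0 j : M4)) H R)) 0 :=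
      π'.hasFDerivAt.comp_hasDerivAt (0 : ℝ) (hasDerivAt_PP p _ H R)
    have h3 : (ψ ∘ fun t : ℝ => e0 + t • d) = fun t : ℝ =>
        π' (PP p (fun j => NormedSpace.exp (t • H j) * (x0 j : M4)) R) := by
      funext t
      simp only [Function.comp, ψ]
      refine congrArg π' ?_
      apply PP_congr
      intro j hj
      simp only [yy, hj, dif_pos]
      have := hK3 ⟨j, hj⟩
      have q1 : (((e0 + t • d).1 ⟨j, hj⟩ : suAlgebra (Fin 4)) : M4) = t • H j := by
        change (0 : M4) + t • H j = _
        rw [zero_add]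
      have q2 : (((e0 + t • d).2 ⟨j, hj⟩ : suAlgebra (Fin 4)) : M4) = K ⟨j, hj⟩ := by
        change K ⟨j, hj⟩ + t • (0 : M4) = _
        rw [smul_zero, add_zero]
      rw [q1, q2, this]
    rw [h3] at h1
    rw [h1.unique h2, ← hH2]
    rw [← hwz, ← hvw]
    rfl
  have hN := null_short hn A' hR π
  have := null_submersion μ volume ψ (contDiff_omega_iff_analyticOnNhd.1 hψC) hfd hN
  refine measure_mono_null ?_ this
  intro e he
  simp only [Set.mem_setOf_eq, hcon] at he
  exact ⟨_, he, rfl⟩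

end assembly
end BW

/-- **Linear complexity growth for the brickwork architecture.**  For even `n ≥ 2` and
`T ≤ 4^n − 1` blocks, with unit probability over the Haar-random gates, the unitary
implemented by the brickwork circuit with `R = T·n(n−1)` gates has exact circuit complexity
at least `R/(9n(n−1)) − n/3`. -/
theorem brickwork_linear_growth
    (n T : ℕ) (hn : 2 ≤ n) (he : n % 2 = 0) (hT : T ≤ 4 ^ n - 1) :
    ∀ᵐ x ∂(muSU4 (T * (n * (n - 1)))),
      ((T * (n * (n - 1)) : ℕ) : ℝ) / (9 * (n : ℝ) * ((n : ℝ) - 1)) - (n : ℝ) / 3 ≤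
        (Cu n (contract (brickwork n T hn he) x) : ℝ) := by
  obtain ⟨W, hW, hWT⟩ := BW.rank_lower n hn he T hT
  have key : ∀ R' : ℕ, ∀ A' : Architecture n R', ∀ᵐ x ∂(muSU4 (T * (n * (n - 1)))),
      9 * R' + 3 * n < T → contract (brickwork n T hn he) x ∉ Set.range (contract A') := by
    intro R' A'
    by_cases h : 9 * R' + 3 * n < T
    · have := BW.null_main hn (BW.bp n hn he) (BW.bp_ne n hn he) (brickwork n T hn he)
        (BW.brickwork_eq n T hn he) W hW hWT A' h
      rw [ae_iff]
      simpa [h] using this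
    · exact Filter.Eventually.of_forall fun x hx => absurd hx h
  have key2 : ∀ᵐ x ∂(muSU4 (T * (n * (n - 1)))), ∀ R' : ℕ, ∀ A' : Architecture n R',
      9 * R' + 3 * n < T → contract (brickwork n T hn he) x ∉ Set.range (contract A') := by
    rw [ae_all_iff]
    intro R'
    haveI : Countable (Architecture n R') :=
      inferInstanceAs (Countable (Fin R' → {p : Fin n × Fin n // p.1 ≠ p.2}))
    rw [ae_all_iff]
    exact key R'
  filter_upwards [key2] with x hx
  have hne : {R | ∃ A : Architecture n R, ∃ y : Fin R → SU4,
      contract A y = contract (brickwork n T hn he) x}.Nonempty := ⟨_, _, x, rfl⟩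
  obtain ⟨A', y, hy⟩ := Nat.sInf_mem hne
  have h1 : ¬ (9 * Cu n (contract (brickwork n T hn he) x) + 3 * n < T) :=
    fun h => hx _ A' h ⟨y, hy⟩
  have h2 : (T : ℝ) ≤ 9 * (Cu n (contract (brickwork n T hn he) x) : ℝ) + 3 * n := by
    exact_mod_cast not_lt.1 h1
  have hn' : (2 : ℝ) ≤ n := by exact_mod_cast hn
  have h3 : ((T * (n * (n - 1)) : ℕ) : ℝ) / (9 * (n : ℝ) * ((n : ℝ) - 1)) = T / 9 := by
    rw [Nat.cast_mul, Nat.cast_mul, Nat.cast_sub (by omega), Nat.cast_one]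
    have : (n : ℝ) - 1 ≠ 0 := by linarith
    have : (n : ℝ) ≠ 0 := by linarith
    field_simp
  rw [h3]
  linarith
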